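/- Let f be an area-preserving homeomorphism of the closed annulus 𝔸 = (ℝ/ℤ)×[-1,1] admitting a lift, and assume f is NICIS. Then every nonempty f-invariant open set U ⊆ Int𝔸 (i.e. with f(U) = U) is dense in Int𝔸. -/

import Mathlib

open MeasureTheory Set

attribute [local instance] MeasureTheory.Measure.Subtype.measureSpace

noncomputable section

/-- The closed annulus `𝔸 = (ℝ/ℤ) × [-1,1]`. -/
abbrev Annulus := AddCircle (1 : ℝ) × (Set.Icc (-1 : ℝ) 1)

/-- The universal cover `ℝ × [-1,1]` of the closed annulus. -/
abbrev AnnulusCover := ℝ × (Set.Icc (-1 : ℝ) 1)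

/-- The covering projection `ℝ × [-1,1] → (ℝ/ℤ) × [-1,1]`. -/
def annulusProj (z : AnnulusCover) : Annulus := ((z.1 : AddCircle (1 : ℝ)), z.2)

/-- The interior `(ℝ/ℤ) × (-1,1)` of the closed annulus. -/
def annulusInt : Set Annulus := {z | -1 < (z.2 : ℝ) ∧ (z.2 : ℝ) < 1}

/-- The upper boundary circle `(ℝ/ℤ) × {1}`. -/
def annulusBdryPlus : Set Annulus := {z | (z.2 : ℝ) = 1}

/-- `ft` is a lift of the homeomorphism `f` of the annulus: it commutes with the deck
transformation `(x,y) ↦ (x+1,y)` and descends to `f`. -/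
def IsLift (f : Annulus ≃ₜ Annulus) (ft : AnnulusCover ≃ₜ AnnulusCover) : Prop :=
  (∀ z : AnnulusCover, ft (z.1 + 1, z.2) = ((ft z).1 + 1, (ft z).2)) ∧
  (∀ z : AnnulusCover, f (annulusProj z) = annulusProj (ft z))

/-- `f` admits no nonempty compact invariant set contained in the interior of the annulus. -/
def NICIS (f : Annulus ≃ₜ Annulus) : Prop :=
  ¬ ∃ K : Set Annulus, K.Nonempty ∧ IsCompact K ∧ f '' K = K ∧ K ⊆ annulusInt

/-! ### Continuous logarithms -/

/-- A nowhere vanishing continuous function on a simply connected space has a continuous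
logarithm. -/
theorem exists_continuous_log {X : Type*} [TopologicalSpace X] [SimplyConnectedSpace X]
    [LocallyPathConnectedSpace X] {g : X → ℂ} (hg : Continuous g) (h0 : ∀ x, g x ≠ 0) :
    ∃ l : X → ℂ, Continuous l ∧ ∀ x, Complex.exp (l x) = g x := by
  obtain ⟨x₀⟩ : Nonempty X := inferInstance
  obtain ⟨l, ⟨-, hl⟩, -⟩ := Complex.isCoveringMapOn_exp.existsUnique_continuousMap_lifts
    ⟨g, hg⟩ (Complex.exp_log (h0 x₀)) (fun x ↦ h0 x)
  exact ⟨l, l.continuous, fun x ↦ congr($hl x)⟩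

/-- A continuous function on a preconnected set whose exponential is constant is constant. -/
theorem IsPreconnected.eq_of_exp_eq {X : Type*} [TopologicalSpace X] {s : Set X}
    (hs : IsPreconnected s) {u : X → ℂ} (hu : ContinuousOn u s) {c : ℂ}
    (hc : ∀ x ∈ s, Complex.exp (u x) = c) {x y : X} (hx : x ∈ s) (hy : y ∈ s) : u x = u y :=
  Complex.isCoveringMap_exp.constOn_of_comp hs hu
    (fun a ha a' ha' ↦ Subtype.ext ((hc a ha).trans (hc a' ha').symm)) hx hy

theorem eq_of_exp_eq_const {X : Type*} [TopologicalSpace X] [PreconnectedSpace X]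
    {u : X → ℂ} (hu : Continuous u) {c : ℂ}
    (hc : ∀ x, Complex.exp (u x) = c) (x y : X) : u x = u y :=
  isPreconnected_univ.eq_of_exp_eq hu.continuousOn (fun x _ ↦ hc x) (mem_univ x) (mem_univ y)

/-! ### The degree of a planar homeomorphism -/

/-- `M` is a continuous logarithm of `H (z + exp ζ) - H z`, and `d` is the number of turns
`H w - H z` makes around the origin while `w` turns once around `z`. -/
structure IsPairLift (H : ℂ ≃ₜ ℂ) (M : ℂ → ℂ → ℂ) (d : ℤ) : Prop where
  cont : Continuous (fun p : ℂ × ℂ ↦ M p.1 p.2)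
  exp_eq : ∀ z ζ, Complex.exp (M z ζ) = H (z + Complex.exp ζ) - H z
  shift : ∀ z ζ, M z (ζ + 2 * Real.pi * Complex.I) = M z ζ + d * (2 * Real.pi * Complex.I)

namespace IsPairLift

theorem exists_lift (H : ℂ ≃ₜ ℂ) : ∃ M d, IsPairLift H M d := by
  obtain ⟨l, hl, hexp⟩ := exists_continuous_log (X := ℂ × ℂ)
    (g := fun p ↦ H (p.1 + Complex.exp p.2) - H p.1) (by fun_prop)
    (fun p ↦ sub_ne_zero.2 fun h ↦ Complex.exp_ne_zero p.2 (by simpa using H.injective h))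
  have hc : ∀ p : ℂ × ℂ,
      Complex.exp (l (p.1, p.2 + 2 * Real.pi * Complex.I) - l p) = 1 := by
    intro p
    have h1 : Complex.exp (p.2 + 2 * Real.pi * Complex.I) = Complex.exp p.2 := by
      rw [Complex.exp_add, Complex.exp_two_pi_mul_I, mul_one]
    rw [Complex.exp_sub, hexp]
    simp only [h1]
    rw [← hexp p, div_self (Complex.exp_ne_zero _)]
  obtain ⟨d, hd⟩ := Complex.exp_eq_one_iff.1 (hc 0)
  refine ⟨fun z ζ ↦ l (z, ζ), d, hl, fun z ζ ↦ hexp (z, ζ), fun z ζ ↦ ?_⟩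
  have := eq_of_exp_eq_const (by fun_prop) hc (z, ζ) 0
  rw [hd] at this
  linear_combination this

theorem shift_int {H : ℂ ≃ₜ ℂ} {M : ℂ → ℂ → ℂ} {d : ℤ} (h : IsPairLift H M d) (z ζ : ℂ) (n : ℤ) :
    M z (ζ + n * (2 * Real.pi * Complex.I)) =
      M z ζ + n * (d * (2 * Real.pi * Complex.I)) := by
  induction n using Int.induction_on with
  | zero => simp
  | succ n ih =>
    have := h.shift z (ζ + n * (2 * Real.pi * Complex.I))
    push_cast at ih ⊢
    rw [show ζ + (n + 1) * (2 * Real.pi * Complex.I)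
      = ζ + n * (2 * Real.pi * Complex.I) + 2 * Real.pi * Complex.I by ring, this, ih]
    ring
  | pred n ih =>
    have := h.shift z (ζ + (-n - 1) * (2 * Real.pi * Complex.I))
    push_cast at ih ⊢
    rw [show ζ + (-n - 1) * (2 * Real.pi * Complex.I) + 2 * Real.pi * Complex.I
      = ζ + -n * (2 * Real.pi * Complex.I) by ring, ih] at this
    linear_combination -this

theorem degree_unique {H : ℂ ≃ₜ ℂ} {M M' : ℂ → ℂ → ℂ} {d d' : ℤ} (h : IsPairLift H M d)
    (h' : IsPairLift H M' d') : d = d' := by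
  have h1 := h.cont
  have h2 := h'.cont
  have hc : ∀ p : ℂ × ℂ, Complex.exp (M p.1 p.2 - M' p.1 p.2) = 1 := by
    intro p
    rw [Complex.exp_sub, h.exp_eq, ← h'.exp_eq, div_self (Complex.exp_ne_zero _)]
  have := eq_of_exp_eq_const (by fun_prop) hc (0, 0) (0, 0 + 2 * Real.pi * Complex.I)
  simp only [h.shift, h'.shift] at this
  have h3 : ((d : ℂ) - d') * (2 * Real.pi * Complex.I) = 0 := by linear_combination -this
  have h4 := (mul_eq_zero.1 h3).resolve_right Complex.two_pi_I_ne_zero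
  exact_mod_cast sub_eq_zero.1 h4

theorem one : IsPairLift 1 (fun _ ζ ↦ ζ) 1 where
  cont := by fun_prop
  exp_eq := by simp
  shift := by simp

theorem mul {G H : ℂ ≃ₜ ℂ} {M N : ℂ → ℂ → ℂ} {d e : ℤ} (hG : IsPairLift G M d)
    (hH : IsPairLift H N e) : IsPairLift (G * H) (fun z ζ ↦ M (H z) (N z ζ)) (d * e) where
  cont := by
    have h1 := hH.cont
    exact hG.cont.comp (f := fun p : ℂ × ℂ ↦ (H p.1, N p.1 p.2)) (by fun_prop)
  exp_eq z ζ := by simp [hG.exp_eq, hH.exp_eq]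
  shift z ζ := by
    rw [hH.shift, hG.shift_int]
    push_cast
    ring

/-- The square of a planar homeomorphism has degree one. -/
theorem exists_sq (G : ℂ ≃ₜ ℂ) : ∃ M, IsPairLift (G * G) M 1 := by
  obtain ⟨M, d, hM⟩ := exists_lift G
  obtain ⟨N, e, hN⟩ := exists_lift G⁻¹
  have hde : d * e = 1 := by
    have := hM.mul hN
    rw [mul_inv_cancel] at this
    exact this.degree_unique one
  have hdd : d * d = 1 := by
    rcases Int.eq_one_or_neg_one_of_mul_eq_one hde with h | h <;> simp [h]
  have := hM.mul hM
  rw [hdd] at this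
  exact ⟨_, this⟩

/-- The rotation of the pair `(z, w)` is the rotation of the pair `(w, z)`. -/
theorem symm {H : ℂ ≃ₜ ℂ} {M : ℂ → ℂ → ℂ} (h : IsPairLift H M 1) (z ζ : ℂ) :
    M (z + Complex.exp ζ) (ζ + Real.pi * Complex.I) = M z ζ + Real.pi * Complex.I := by
  have hM := h.cont
  let S : ℂ × ℂ → ℂ × ℂ := fun p ↦ (p.1 + Complex.exp p.2, p.2 + Real.pi * Complex.I)
  have hS : Continuous S := by fun_prop
  let u : ℂ × ℂ → ℂ := fun p ↦
    M (S p).1 (S p).2 - M p.1 p.2 - Real.pi * Complex.I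
  have hu : Continuous u := ((hM.comp hS).sub hM).sub continuous_const
  have hexp : ∀ p, Complex.exp (u p) = 1 := by
    intro p
    simp only [u, S, Complex.exp_sub, h.exp_eq, Complex.exp_add, Complex.exp_pi_mul_I]
    have : H (p.1 + Complex.exp p.2) - H p.1 ≠ 0 :=
      sub_ne_zero.2 fun h ↦ Complex.exp_ne_zero p.2 (by simpa using H.injective h)
    field_simp
    simp
  have h1 := eq_of_exp_eq_const hu hexp (z, ζ) (S (z, ζ))
  have hSS : S (S (z, ζ)) = (z, ζ + 2 * Real.pi * Complex.I) := by
    simp only [S, Complex.exp_add, Complex.exp_pi_mul_I, Prod.mk.injEq]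
    constructor <;> ring
  simp only [u, hSS, h.shift] at h1
  simp only [S] at h1
  push_cast at h1
  linear_combination h1 / 2

end IsPairLift

/-! ### Brouwer's lemma on translation arcs -/

/-- For a fixed point free planar homeomorphism of degree one, a curve which is invariant under
the dynamics does not close up into a simple loop. -/
theorem IsPairLift.not_simple_loop {H : ℂ ≃ₜ ℂ} {M : ℂ → ℂ → ℂ} (h : IsPairLift H M 1)
    (hfix : ∀ z, H z ≠ z) {β : ℝ → ℂ} (hβ : Continuous β) {σ T : ℝ} (hσ : 0 ≤ σ)
    (hσT : σ + 1 < T) (hT : 2 ≤ T) (hstep : ∀ s, 0 ≤ s → s ≤ T - 1 → β (s + 1) = H (β s))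
    (hinj : ∀ s t, 0 ≤ s → s < t → t < T → β s ≠ β t) : β T ≠ β σ := by
  intro hclose
  have hM := h.cont
  obtain ⟨g, hg⟩ : ∃ g, g = min 1 (T - σ - 1) := ⟨_, rfl⟩
  have hg0 : 0 < g := by rw [hg]; exact lt_min one_pos (by linarith)
  have hg1 : g ≤ 1 := hg ▸ min_le_left _ _
  have hgT : g ≤ T - σ - 1 := hg ▸ min_le_right _ _
  -- a continuous logarithm of the chords of the curve with gap in `[g, T - σ - g]`
  let cd : ℝ → ℝ := fun d ↦ max g (min d (T - σ - g))
  let cs : ℝ × ℝ → ℝ := fun p ↦ max 0 (min p.1 (T - cd p.2))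
  have hcd : ∀ d, g ≤ cd d ∧ cd d ≤ T - σ - g := fun d ↦
    ⟨le_max_left _ _, max_le (by linarith) (min_le_right _ _)⟩
  have hcs : ∀ p, 0 ≤ cs p ∧ cs p + cd p.2 ≤ T := fun p ↦ by
    refine ⟨le_max_left _ _, ?_⟩
    have : cs p ≤ T - cd p.2 := max_le (by linarith [(hcd p.2).2]) (min_le_right _ _)
    linarith
  obtain ⟨Θ', hΘ'c, hΘ'⟩ := exists_continuous_log (X := ℝ × ℝ)
    (g := fun p ↦ β (cs p + cd p.2) - β (cs p)) (by fun_prop) (by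
      intro p
      obtain ⟨h1, h2⟩ := hcd p.2
      obtain ⟨h3, h4⟩ := hcs p
      refine sub_ne_zero.2 fun heq ↦ ?_
      rcases h4.lt_or_eq with h5 | h5
      · exact hinj _ _ h3 (by linarith) h5 heq.symm
      · rw [h5, hclose] at heq
        exact hinj _ _ hσ (by linarith : σ < cs p) (by linarith) heq)
  let Θ : ℝ → ℝ → ℂ := fun s d ↦ Θ' (s, d)
  have hΘc : Continuous fun p : ℝ × ℝ ↦ Θ p.1 p.2 := hΘ'c
  have hΘ : ∀ s d, 0 ≤ s → s + d ≤ T → g ≤ d → d ≤ T - σ - g →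
      Complex.exp (Θ s d) = β (s + d) - β s := by
    intro s d h1 h2 h3 h4
    have h5 : cd d = d := by simp only [cd]; rw [min_eq_left h4, max_eq_right h3]
    have h6 : cs (s, d) = s := by
      simp only [cs, h5]; rw [min_eq_left (by linarith), max_eq_right h1]
    simp only [Θ, hΘ', h5, h6]
  obtain ⟨θ, hθc, hθ⟩ := exists_continuous_log (X := ℂ) (g := fun z ↦ H z - z) (by fun_prop)
    (fun z ↦ sub_ne_zero.2 (hfix z))
  have hdisp : ∀ z, M z (θ z) - θ (H z) = M 0 (θ 0) - θ (H 0) := fun z ↦ by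
    refine eq_of_exp_eq_const (u := fun z ↦ M z (θ z) - θ (H z)) (c := 1) ?_ (fun z ↦ ?_) z 0
    · exact (hM.comp (f := fun z ↦ (z, θ z)) (by fun_prop)).sub (by fun_prop)
    · rw [Complex.exp_sub, h.exp_eq, hθ, hθ, add_sub_cancel,
        div_self (sub_ne_zero.2 (hfix (H z)))]
  have hchord : ∀ s, 0 ≤ s → s ≤ T - 1 →
      Complex.exp (Θ s 1 - θ (β s)) = 1 := fun s h1 h2 ↦ by
    rw [Complex.exp_sub, hΘ s 1 h1 (by linarith) hg1 (by linarith), hθ, hstep s h1 h2,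
      div_self (sub_ne_zero.2 (hfix _))]
  obtain ⟨n, hn⟩ := Complex.exp_eq_one_iff.1 (hchord 0 le_rfl (by linarith))
  have hunit : ∀ s, 0 ≤ s → s ≤ T - 1 →
      Θ s 1 = θ (β s) + n * (2 * Real.pi * Complex.I) := fun s h1 h2 ↦ by
    rw [← hn, ← (isPreconnected_Icc (a := (0 : ℝ)) (b := T - 1)).eq_of_exp_eq
      (u := fun s ↦ Θ s 1 - θ (β s)) (by fun_prop) (fun s hs ↦ hchord s hs.1 hs.2)
      ⟨h1, h2⟩ ⟨le_rfl, by linarith⟩]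
    ring
  have hunitM : ∀ s, 0 ≤ s → s ≤ T - 1 →
      M (β s) (Θ s 1) = θ (β (s + 1)) + n * (2 * Real.pi * Complex.I)
        + (M 0 (θ 0) - θ (H 0)) := fun s h1 h2 ↦ by
    rw [hunit s h1 h2, h.shift_int, hstep s h1 h2, ← hdisp (β s)]
    push_cast
    ring
  let Q : Set (ℝ × ℝ) := {p | 0 ≤ p.1} ∩ {p | p.1 + p.2 ≤ T - 1} ∩ {p | g ≤ p.2} ∩
    {p | p.2 ≤ T - σ - g}
  have hQ : IsPreconnected Q := by
    refine Convex.isPreconnected (((Convex.inter ?_ ?_).inter ?_).inter ?_)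
    · exact convex_halfSpace_ge (LinearMap.fst ℝ ℝ ℝ).isLinear 0
    · exact convex_halfSpace_le (LinearMap.fst ℝ ℝ ℝ + LinearMap.snd ℝ ℝ ℝ).isLinear (T - 1)
    · exact convex_halfSpace_ge (LinearMap.snd ℝ ℝ ℝ).isLinear g
    · exact convex_halfSpace_le (LinearMap.snd ℝ ℝ ℝ).isLinear (T - σ - g)
  have hflow : M (β σ) (Θ σ (T - 1 - σ)) - Θ (σ + 1) (T - 1 - σ) =
      M (β 0) (Θ 0 1) - Θ (0 + 1) 1 := by
    refine hQ.eq_of_exp_eq (u := fun p : ℝ × ℝ ↦ M (β p.1) (Θ p.1 p.2) - Θ (p.1 + 1) p.2)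
      (c := 1) ?_ ?_ (x := (σ, T - 1 - σ)) (y := (0, 1)) ?_ ?_
    · refine Continuous.continuousOn (Continuous.sub ?_ ?_)
      · exact hM.comp (f := fun p : ℝ × ℝ ↦ (β p.1, Θ p.1 p.2)) (by fun_prop)
      · exact hΘc.comp (f := fun p : ℝ × ℝ ↦ (p.1 + 1, p.2)) (by fun_prop)
    · rintro ⟨s, d⟩ ⟨⟨⟨h1, h2⟩, h3⟩, h4⟩
      simp only [mem_ofPred_eq] at h1 h2 h3 h4
      have h5 : β (s + 1 + d) = H (β (s + d)) := by
        rw [← hstep (s + d) (by linarith) h2]; ring_nf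
      rw [Complex.exp_sub, h.exp_eq, hΘ s d h1 (by linarith) h3 h4,
        hΘ (s + 1) d (by linarith) (by linarith) h3 h4, h5, hstep s h1 (by linarith),
        add_sub_cancel, div_self]
      exact sub_ne_zero.2 fun h6 ↦
        hinj s (s + d) h1 (by linarith) (by linarith) (H.injective h6).symm
    · refine ⟨⟨⟨hσ, ?_⟩, ?_⟩, ?_⟩ <;> simp only [mem_ofPred_eq] <;> linarith
    · refine ⟨⟨⟨?_, ?_⟩, ?_⟩, ?_⟩ <;> simp only [mem_ofPred_eq] <;> linarith
  have hturn : ∀ t ∈ Icc (σ + g) (T - g),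
      Complex.exp (Θ t (T - t) - Θ σ (t - σ)) = -1 := by
    rintro t ⟨h1, h2⟩
    rw [Complex.exp_sub, hΘ t (T - t) (by linarith) (by linarith) (by linarith) (by linarith),
      hΘ σ (t - σ) hσ (by linarith) (by linarith) (by linarith), add_sub_cancel, add_sub_cancel,
      hclose, ← neg_sub, neg_div, div_self]
    exact sub_ne_zero.2 (hinj σ t hσ (by linarith) (by linarith)).symm
  have hturn_eq : Θ (T - 1) (T - (T - 1)) - Θ σ (T - 1 - σ) =
      Θ (σ + 1) (T - (σ + 1)) - Θ σ (σ + 1 - σ) :=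
    isPreconnected_Icc.eq_of_exp_eq (u := fun t ↦ Θ t (T - t) - Θ σ (t - σ))
      (Continuous.continuousOn (by
        have h1 : Continuous fun t : ℝ ↦ Θ t (T - t) :=
          hΘc.comp (f := fun t : ℝ ↦ (t, T - t)) (by fun_prop)
        have h2 : Continuous fun t : ℝ ↦ Θ σ (t - σ) :=
          hΘc.comp (f := fun t : ℝ ↦ (σ, t - σ)) (by fun_prop)
        exact h1.sub h2)) hturn
      ⟨by linarith, by linarith⟩ ⟨by linarith, by linarith⟩
  have hexpX := hturn (T - 1) ⟨by linarith, by linarith⟩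
  rw [sub_sub_cancel] at hturn_eq hexpX
  rw [show T - (σ + 1) = T - 1 - σ by ring, add_sub_cancel_left] at hturn_eq
  -- compare the rotation of the closing pair computed in two ways
  have hpair : β σ + Complex.exp (Θ σ (T - 1 - σ)) = β (T - 1) := by
    rw [hΘ σ (T - 1 - σ) hσ (by linarith) (by linarith) (by linarith)]
    ring_nf
  have hsymm := h.symm (β σ) (Θ σ (T - 1 - σ))
  rw [hpair] at hsymm
  obtain ⟨j, hj⟩ : ∃ j : ℤ, Θ (T - 1) 1 - (Θ σ (T - 1 - σ) + Real.pi * Complex.I) =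
      j * (2 * Real.pi * Complex.I) := by
    refine Complex.exp_eq_one_iff.1 ?_
    rw [← sub_sub, Complex.exp_sub, hexpX, Complex.exp_pi_mul_I]
    norm_num
  have hclosing := hunitM (T - 1) (by linarith) le_rfl
  rw [eq_add_of_sub_eq' hj, h.shift_int, hsymm, sub_add_cancel, hclose] at hclosing
  have hopen := hunitM 0 le_rfl (by linarith)
  have hu0 := hunit (0 + 1) (by linarith) (by linarith)
  have huσ := hunit σ hσ (by linarith)
  have hX : Θ (T - 1) 1 - Θ σ (T - 1 - σ) = 0 := by
    push_cast at hclosing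
    linear_combination (1 / 2) * (hturn_eq + hj) + (1 / 2) * (hclosing - hflow - hopen + hu0 - huσ)
  rw [hX] at hexpX
  norm_num at hexpX

/-- An arc from a point to its image extends to a curve on which the dynamics acts by the unit
time shift. -/
theorem exists_orbit_curve (H : ℂ ≃ₜ ℂ) {α : ℝ → ℂ} (hα : Continuous α) (h01 : α 1 = H (α 0))
    (N : ℕ) : ∃ β : ℝ → ℂ, Continuous β ∧ (∀ s ≤ 1, β s = α s) ∧
      ∀ s : ℝ, 0 ≤ s → s ≤ N → β (s + 1) = H (β s) := by
  induction N with
  | zero =>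
    refine ⟨fun s ↦ if s ≤ 1 then α s else H (α (s - 1)), ?_, fun s hs ↦ if_pos hs, ?_⟩
    · refine Continuous.if_le (by fun_prop) (by fun_prop) (by fun_prop) (by fun_prop) ?_
      rintro s rfl
      simpa using h01
    · intro s h0 h1
      have : s = 0 := le_antisymm (by simpa using h1) h0
      simp [this, h01]
  | succ N ih =>
    obtain ⟨β, hβ, hβα, hstep⟩ := ih
    have h0 : β 0 = α 0 := hβα 0 zero_le_one
    have hext : ∀ s : ℝ, 0 ≤ s → s ≤ N + 1 → (if s ≤ 1 then α s else H (β (s - 1))) = β s := by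
      intro s h0 h1
      split_ifs with h
      · exact (hβα s h).symm
      · rw [← hstep (s - 1) (by linarith) (by linarith), sub_add_cancel]
    refine ⟨fun s ↦ if s ≤ 1 then α s else H (β (s - 1)), ?_, fun s hs ↦ if_pos hs, ?_⟩
    · refine Continuous.if_le (by fun_prop) (by fun_prop) (by fun_prop) (by fun_prop) ?_
      rintro s rfl
      simpa [h0] using h01
    · intro s hs hN
      push_cast at hN
      simp only [hext s hs hN]
      rcases hs.eq_or_lt with rfl | hs
      · simp [h0, h01]
      · rw [if_neg (by linarith), add_sub_cancel_right]

/-- **Brouwer's lemma on translation arcs**: for a fixed point free planar homeomorphism of degree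
one, a translation arc does not meet its higher iterates. -/
theorem IsPairLift.iterate_translation_arc_ne {H : ℂ ≃ₜ ℂ} {M : ℂ → ℂ → ℂ}
    (h : IsPairLift H M 1) (hfix : ∀ z, H z ≠ z) {α : ℝ → ℂ} (hα : Continuous α)
    (h01 : α 1 = H (α 0)) (hinj : InjOn α (Icc 0 1))
    (hfree : ∀ s ∈ Ioo (0 : ℝ) 1, ∀ t ∈ Icc (0 : ℝ) 1, H (α s) ≠ α t)
    {a b : ℝ} (ha : a ∈ Icc (0 : ℝ) 1) (hb : b ∈ Icc (0 : ℝ) 1) {n : ℕ} (hn : 2 ≤ n) :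
    H^[n] (α a) ≠ α b := by
  intro hab
  obtain ⟨β, hβ, hβα, hstep⟩ := exists_orbit_curve H hα h01 (n + 1)
  push_cast at hstep
  have hn' : (2 : ℝ) ≤ n := by exact_mod_cast hn
  have hinj2 : ∀ s t : ℝ, 0 ≤ s → s < t → t < 2 → β s ≠ β t := by
    intro s t hs hst ht heq
    rcases le_or_gt t 1 with h1 | h1
    · rw [hβα s (by linarith), hβα t h1] at heq
      exact hst.ne (hinj ⟨hs, by linarith⟩ ⟨by linarith, h1⟩ heq)
    have hβt : β t = H (α (t - 1)) := by
      rw [← hβα (t - 1) (by linarith), ← hstep (t - 1) (by linarith) (by linarith),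
        sub_add_cancel]
    rcases le_or_gt s 1 with h2 | h2
    · rw [hβα s h2, hβt] at heq
      exact hfree (t - 1) ⟨by linarith, by linarith⟩ s ⟨hs, h2⟩ heq.symm
    · have hβs : β s = H (α (s - 1)) := by
        rw [← hβα (s - 1) (by linarith), ← hstep (s - 1) (by linarith) (by linarith),
          sub_add_cancel]
      rw [hβt, hβs] at heq
      have := hinj ⟨by linarith, by linarith⟩ ⟨by linarith, by linarith⟩ (H.injective heq)
      linarith
  have hloc : ∀ m : ℕ, ∀ s t : ℝ, 0 ≤ s → s ≤ m + 1 → s < t → t < s + 1 → t ≤ n + 1 →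
      β s ≠ β t := by
    intro m
    induction m with
    | zero =>
      intro s t h1 h2 h3 h4 _
      push_cast at h2
      exact hinj2 s t h1 h3 (by linarith)
    | succ m ih =>
      intro s t h1 h2 h3 h4 h5 heq
      push_cast at h2
      rcases le_or_gt s 1 with h6 | h6
      · exact hinj2 s t h1 h3 (by linarith) heq
      · refine ih (s - 1) (t - 1) (by linarith) (by linarith) (by linarith) (by linarith)
          (by linarith) (H.injective ?_)
        rw [← hstep _ (by linarith) (by linarith), ← hstep _ (by linarith) (by linarith),
          sub_add_cancel, sub_add_cancel, heq]
  have hiter : ∀ m : ℕ, m ≤ n → β (m + a) = H^[m] (α a) := by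
    intro m
    induction m with
    | zero => intro _; simpa using hβα a ha.2
    | succ m ih =>
      intro hm
      have hm' : (m : ℝ) + 1 ≤ n := by exact_mod_cast hm
      rw [Function.iterate_succ_apply', ← ih (by omega),
        ← hstep _ (by linarith [ha.1, m.cast_nonneg (α := ℝ)]) (by linarith [ha.2])]
      push_cast
      ring_nf
  let B : Set (ℝ × ℝ) := Icc (0 : ℝ) (n + 1) ×ˢ Icc (0 : ℝ) (n + 1) ∩
    ({p | p.1 + 1 ≤ p.2} ∩ {p | β p.1 = β p.2})
  have hBc : IsCompact B := (isCompact_Icc.prod isCompact_Icc).inter_right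
    ((isClosed_le (by fun_prop) (by fun_prop)).inter (isClosed_eq (by fun_prop) (by fun_prop)))
  have hBne : B.Nonempty := by
    refine ⟨(b, n + a), ⟨⟨hb.1, ?_⟩, ?_, ?_⟩, ?_, ?_⟩
    · linarith [hb.2]
    · exact add_nonneg n.cast_nonneg ha.1
    · simp only
      linarith [ha.2]
    · show b + 1 ≤ n + a
      linarith [ha.1, hb.2]
    · show β b = β (n + a)
      rw [hiter n le_rfl, hab, hβα b hb.2]
  obtain ⟨⟨σ, T⟩, ⟨⟨⟨hσ, -⟩, hT0, hTn⟩, hσT, hcl⟩, hmin⟩ :=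
    hBc.exists_isMinOn hBne continuous_snd.continuousOn
  simp only [mem_ofPred_eq] at hσ hT0 hTn hσT hcl
  have hmin' : ∀ s t, 0 ≤ s → s + 1 ≤ t → t < T → β s ≠ β t := by
    intro s t h1 h2 h3 heq
    have := hmin (a := (s, t)) ⟨⟨⟨h1, by linarith⟩, by simp only; linarith, by simp only; linarith⟩,
      h2, heq⟩
    simp only [mem_ofPred_eq] at this
    linarith
  have hT2 : 2 ≤ T := by
    by_contra hlt
    exact hinj2 σ T hσ (by linarith) (by linarith) hcl
  have hσ1 : σ < 1 := by
    by_contra hge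
    refine hmin' (σ - 1) (T - 1) (by linarith) (by linarith) (by linarith) (H.injective ?_)
    rw [← hstep _ (by linarith) (by linarith), ← hstep _ (by linarith) (by linarith),
      sub_add_cancel, sub_add_cancel, hcl]
  refine h.not_simple_loop hfix hβ hσ (by linarith) hT2
    (fun s h1 h2 ↦ hstep s h1 (by linarith)) (fun s t h1 h2 h3 ↦ ?_) hcl.symm
  rcases le_or_gt (s + 1) t with h4 | h4
  · exact hmin' s t h1 h4 h3
  · exact hloc n s t h1 (by linarith) h2 h4 (by linarith)

/-- A point which is not fixed is the centre of a maximal free ball, with a boundary point mapped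
to the boundary. -/
theorem exists_maximal_free_ball {H : ℂ ≃ₜ ℂ} (hfix : ∀ z, H z ≠ z) (x : ℂ) :
    ∃ r u, 0 < r ∧ dist u x = r ∧ dist (H u) x = r ∧
      ∀ y, dist y x < r → r < dist (H y) x := by
  let m : ℂ → ℝ := fun y ↦ max (dist y x) (dist (H y) x)
  have hmc : Continuous m := by fun_prop
  obtain ⟨u, hu⟩ := hmc.exists_forall_le (Filter.tendsto_atTop_mono (fun y ↦ le_max_left _ _)
    (tendsto_dist_right_cocompact_atTop x))
  have hr : 0 < m u := by
    by_contra! hle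
    have h1 := dist_le_zero.1 ((le_max_left _ _).trans hle)
    have h2 := dist_le_zero.1 ((le_max_right _ _).trans hle)
    exact hfix u (h2.trans h1.symm)
  have hball : ∀ y, dist y x < m u → m u ≤ dist (H y) x := fun y hy ↦
    (le_max_iff.1 (hu y)).resolve_left hy.not_ge
  have happrox : ∀ w, dist w x ≤ m u → w ∈ closure (Metric.ball x (m u)) := fun w hw ↦ by
    rwa [closure_ball x hr.ne', Metric.mem_closedBall]
  refine ⟨m u, u, hr, (le_max_left _ _).antisymm ?_, (le_max_right _ _).antisymm ?_, ?_⟩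
  · by_contra! hlt
    obtain ⟨w, hw1, hw2⟩ := mem_closure_iff.1 (happrox (H u) (le_max_right _ _))
      (H.symm ⁻¹' Metric.ball x (m u)) (Metric.isOpen_ball.preimage H.symm.continuous)
      (by rwa [mem_preimage, H.symm_apply_apply, Metric.mem_ball])
    have := hball (H.symm w) (by simpa using hw1)
    rw [H.apply_symm_apply] at this
    exact this.not_gt (by simpa using hw2)
  · by_contra! hlt
    obtain ⟨w, hw1, hw2⟩ := mem_closure_iff.1 (happrox u (le_max_left _ _))
      (H ⁻¹' Metric.ball x (m u)) (Metric.isOpen_ball.preimage H.continuous)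
      hlt
    exact (hball w (by simpa using hw2)).not_gt (by simpa using hw1)
  · intro y hy
    refine (hball y hy).lt_of_ne fun heq ↦ ?_
    obtain ⟨w, hw1, hw2⟩ := mem_closure_iff.1 (happrox (H y) heq.ge)
      (H.symm ⁻¹' Metric.ball x (m u)) (Metric.isOpen_ball.preimage H.symm.continuous)
      (by simpa using hy)
    have := hball (H.symm w) (by simpa using hw1)
    rw [H.apply_symm_apply] at this
    exact this.not_gt (by simpa using hw2)

/-- Four points which are increasing for a linear form are joined by a broken line which is an
arc; it stays in a ball whose interior contains the two inner points and whose closure contains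
the two end points. -/
theorem exists_broken_line {x u p q v w : ℂ} {r : ℝ} (hu : dist u x ≤ r) (hv : dist v x ≤ r)
    (hp : dist p x < r) (hq : dist q x < r) (hup : 0 < inner ℝ w (p - u))
    (hpq : 0 < inner ℝ w (q - p)) (hqv : 0 < inner ℝ w (v - q)) :
    ∃ α : ℝ → ℂ, Continuous α ∧ α 0 = u ∧ α 1 = v ∧ InjOn α (Icc 0 1) ∧
      (∀ t ∈ Ioo (0 : ℝ) 1, dist (α t) x < r) ∧ α (1 / 3) = p ∧ α (2 / 3) = q := by
  let c : ℝ → ℝ → ℝ := fun i t ↦ max 0 (min 1 (3 * t - i))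
  have hcc : ∀ i, Continuous (c i) := fun i ↦ by fun_prop
  have hmono : ∀ i, Monotone (c i) := fun i s t hst ↦
    max_le_max le_rfl (min_le_min le_rfl (by linarith))
  have hanti : ∀ i t, c (i + 1) t ≤ c i t := fun i t ↦
    max_le_max le_rfl (min_le_min le_rfl (by linarith))
  have h0 : ∀ i t, 0 ≤ c i t := fun i t ↦ le_max_left _ _
  have h1 : ∀ i t, c i t ≤ 1 := fun i t ↦ max_le zero_le_one (min_le_left _ _)
  have hsum : ∀ t ∈ Icc (0 : ℝ) 1, c 0 t + c 1 t + c 2 t = 3 * t := by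
    rintro t ⟨ht0, ht1⟩
    simp only [c]
    rcases max_cases 0 (min 1 (3 * t - 0)) with ⟨e1, l1⟩ | ⟨e1, l1⟩ <;>
    rcases max_cases 0 (min 1 (3 * t - 1)) with ⟨e2, l2⟩ | ⟨e2, l2⟩ <;>
    rcases max_cases 0 (min 1 (3 * t - 2)) with ⟨e3, l3⟩ | ⟨e3, l3⟩ <;>
    rcases min_cases 1 (3 * t - 0) with ⟨e4, l4⟩ | ⟨e4, l4⟩ <;>
    rcases min_cases 1 (3 * t - 1) with ⟨e5, l5⟩ | ⟨e5, l5⟩ <;>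
    rcases min_cases 1 (3 * t - 2) with ⟨e6, l6⟩ | ⟨e6, l6⟩ <;> linarith
  let α : ℝ → ℂ := fun t ↦ u + (c 0 t • (p - u) + c 1 t • (q - p) + c 2 t • (v - q))
  have hlt : ∀ s ∈ Icc (0 : ℝ) 1, ∀ t ∈ Icc (0 : ℝ) 1, s < t →
      inner ℝ w (α s) < inner ℝ w (α t) := by
    intro s hs t ht hst
    simp only [α, inner_add_right, inner_smul_right]
    have e1 := hsum s hs
    have e2 := hsum t ht
    obtain ⟨k, hk0, hk1, hk2, hk3⟩ : ∃ k, 0 < k ∧ k ≤ inner ℝ w (p - u) ∧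
        k ≤ inner ℝ w (q - p) ∧ k ≤ inner ℝ w (v - q) :=
      ⟨min (inner ℝ w (p - u)) (min (inner ℝ w (q - p)) (inner ℝ w (v - q))), by
        simp only [lt_min_iff]; exact ⟨hup, hpq, hqv⟩, by simp, by simp, by simp⟩
    have m0 := mul_le_mul_of_nonneg_left hk1 (sub_nonneg.2 (hmono 0 hst.le))
    have m1 := mul_le_mul_of_nonneg_left hk2 (sub_nonneg.2 (hmono 1 hst.le))
    have m2 := mul_le_mul_of_nonneg_left hk3 (sub_nonneg.2 (hmono 2 hst.le))
    nlinarith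
  refine ⟨α, ?_, ?_, ?_, ?_, ?_, ?_, ?_⟩
  · have := hcc 0
    have := hcc 1
    have := hcc 2
    fun_prop
  · simp [α, c]
  · norm_num [α, c]
  · intro s hs t ht hst
    rcases lt_trichotomy s t with h | h | h
    · exact absurd (hlt s hs t ht h) (by rw [hst]; exact lt_irrefl _)
    · exact h
    · exact absurd (hlt t ht s hs h) (by rw [hst]; exact lt_irrefl _)
  · intro t ht
    have hα : α t - x = (1 - c 0 t) • (u - x) + (c 0 t - c 1 t) • (p - x)
        + (c 1 t - c 2 t) • (q - x) + c 2 t • (v - x) := by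
      simp only [α, Complex.real_smul]
      push_cast
      ring
    have hpos : 0 < c 0 t - c 2 t := by
      have := hsum t ⟨ht.1.le, ht.2.le⟩
      have := ht.1
      have := ht.2
      have k1 := hanti 0 t
      have k2 := hanti 1 t
      norm_num at k1 k2
      refine sub_pos.2 (lt_of_le_of_ne (k2.trans k1) fun heq ↦ ?_)
      have heq' : c 0 t = t := by linarith
      simp only [c] at heq'
      rcases max_cases 0 (min 1 (3 * t - 0)) with ⟨e1, l1⟩ | ⟨e1, l1⟩ <;>
      rcases min_cases 1 (3 * t - 0) with ⟨e4, l4⟩ | ⟨e4, l4⟩ <;> linarith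
    have k1 := hanti 0 t
    have k2 := hanti 1 t
    norm_num at k1 k2
    rw [dist_eq_norm] at hu hv hp hq ⊢
    rw [hα]
    have n1 : ‖(1 - c 0 t) • (u - x)‖ = (1 - c 0 t) * ‖u - x‖ :=
      norm_smul_of_nonneg (sub_nonneg.2 (h1 0 t)) _
    have n2 : ‖(c 0 t - c 1 t) • (p - x)‖ = (c 0 t - c 1 t) * ‖p - x‖ :=
      norm_smul_of_nonneg (sub_nonneg.2 k1) _
    have n3 : ‖(c 1 t - c 2 t) • (q - x)‖ = (c 1 t - c 2 t) * ‖q - x‖ :=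
      norm_smul_of_nonneg (sub_nonneg.2 k2) _
    have n4 : ‖c 2 t • (v - x)‖ = c 2 t * ‖v - x‖ := norm_smul_of_nonneg (h0 2 t) _
    have b1 := mul_le_mul_of_nonneg_left hu (sub_nonneg.2 (h1 0 t))
    have b4 := mul_le_mul_of_nonneg_left hv (h0 2 t)
    obtain ⟨ρ, hpρ, hρ⟩ : ∃ ρ, ‖p - x‖ ≤ ρ ∧ ‖q - x‖ ≤ ρ ∧ ρ < r :=
      ⟨max ‖p - x‖ ‖q - x‖, le_max_left _ _, le_max_right _ _, max_lt hp hq⟩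
    have b2 := mul_le_mul_of_nonneg_left hpρ (sub_nonneg.2 k1)
    have b3 := mul_le_mul_of_nonneg_left hρ.1 (sub_nonneg.2 k2)
    have b5 := mul_lt_mul_of_pos_left hρ.2 hpos
    refine (norm_add_le _ _).trans_lt ?_
    have t1 := norm_add_le ((1 - c 0 t) • (u - x) + (c 0 t - c 1 t) • (p - x))
      ((c 1 t - c 2 t) • (q - x))
    have t2 := norm_add_le ((1 - c 0 t) • (u - x)) ((c 0 t - c 1 t) • (p - x))
    linarith
  · norm_num [α, c]
  · norm_num [α, c]

/-- **Brouwer**: a fixed point free planar homeomorphism of degree one is wandering. -/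
theorem IsPairLift.exists_wandering_ball {H : ℂ ≃ₜ ℂ} {M : ℂ → ℂ → ℂ}
    (h : IsPairLift H M 1) (hfix : ∀ z, H z ≠ z) (x : ℂ) :
    ∃ δ > 0, ∀ n ≠ 0, ∀ y ∈ Metric.ball x δ, H^[n] y ∉ Metric.ball x δ := by
  obtain ⟨r, u, hr, hu, hv, hfree⟩ := exists_maximal_free_ball hfix x
  obtain ⟨v, hvdef⟩ : ∃ v, v = H u := ⟨_, rfl⟩
  rw [← hvdef] at hv
  have hL : 0 < ‖v - u‖ := norm_pos_iff.2 (sub_ne_zero.2 (hvdef ▸ hfix u))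
  have key : ∀ p q, p ≠ q → dist p x < min r (‖v - u‖ / 2) → dist q x < min r (‖v - u‖ / 2) →
      ∃ α : ℝ → ℂ, Continuous α ∧ α 0 = u ∧ α 1 = v ∧ InjOn α (Icc 0 1) ∧
      (∀ t ∈ Ioo (0 : ℝ) 1, dist (α t) x < r) ∧
      (∃ a ∈ Icc (0 : ℝ) 1, α a = p) ∧ ∃ b ∈ Icc (0 : ℝ) 1, α b = q := by
    intro p q hne hp hq
    wlog hle : 0 ≤ inner ℝ (v - u) (q - p) generalizing p q
    · obtain ⟨α, h1, h2, h3, h4, h5, h6, h7⟩ := this q p hne.symm hq hp (by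
        rw [← neg_sub q p, inner_neg_right]; linarith)
      exact ⟨α, h1, h2, h3, h4, h5, h7, h6⟩
    rw [lt_min_iff] at hp hq
    have hin : ∀ y, dist y x < ‖v - u‖ / 2 → |inner ℝ (v - u) (y - x)| < ‖v - u‖ ^ 2 / 2 := by
      intro y hy
      rw [dist_eq_norm] at hy
      refine (abs_real_inner_le_norm _ _).trans_lt ?_
      nlinarith
    have hmid : inner ℝ (v - u) (v - x) + inner ℝ (v - u) (u - x) = 0 := by
      rw [← inner_add_right, ← sub_sub_sub_cancel_right v u x,
        real_inner_comm, real_inner_add_sub_eq_zero_iff, ← dist_eq_norm, ← dist_eq_norm, hu, hv]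
    have hdif : inner ℝ (v - u) (v - x) - inner ℝ (v - u) (u - x) = ‖v - u‖ ^ 2 := by
      rw [← inner_sub_right, sub_sub_sub_cancel_right, real_inner_self_eq_norm_sq]
    have hA : 0 < inner ℝ (v - u) (p - u) := by
      have := abs_lt.1 (hin p hp.2)
      rw [← sub_sub_sub_cancel_right p u x, inner_sub_right]
      linarith
    have hB : 0 < inner ℝ (v - u) (v - q) := by
      have := abs_lt.1 (hin q hq.2)
      rw [← sub_sub_sub_cancel_right v q x, inner_sub_right]
      linarith
    have hev : ∀ᶠ ε : ℝ in nhdsWithin 0 (Ioi 0), 0 < ε ∧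
        0 < inner ℝ (v - u + ε • (q - p)) (p - u) ∧
        0 < inner ℝ (v - u + ε • (q - p)) (v - q) := by
      refine eventually_mem_nhdsWithin.and ((Filter.Eventually.and ?_ ?_).filter_mono
        nhdsWithin_le_nhds)
      · exact (Continuous.tendsto (by fun_prop) 0).eventually_const_lt (by simpa using hA)
      · exact (Continuous.tendsto (by fun_prop) 0).eventually_const_lt (by simpa using hB)
    obtain ⟨ε, hε, hup, hqv⟩ := hev.exists
    have hpq : 0 < inner ℝ (v - u + ε • (q - p)) (q - p) := by
      rw [inner_add_left, real_inner_smul_left, real_inner_self_eq_norm_sq]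
      have := norm_pos_iff.2 (sub_ne_zero.2 hne.symm)
      positivity
    obtain ⟨α, h1, h2, h3, h4, h5, h6, h7⟩ :=
      exists_broken_line hu.le hv.le hp.1 hq.1 hup hpq hqv
    exact ⟨α, h1, h2, h3, h4, h5, ⟨1 / 3, by norm_num, h6⟩, 2 / 3, by norm_num, h7⟩
  have hδ : 0 < min r (‖v - u‖ / 2) := lt_min hr (by positivity)
  refine ⟨_, hδ, fun n hn y hy hy' ↦ ?_⟩
  rw [Metric.mem_ball] at hy hy'
  rcases (Nat.one_le_iff_ne_zero.2 hn).eq_or_lt with rfl | hn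
  · exact (hfree y (hy.trans_le (min_le_left _ _))).not_gt (hy'.trans_le (min_le_left _ _))
  obtain ⟨α, h1, h2, h3, h4, h5, ⟨a, ha, hay⟩, b, hb, hby⟩ : ∃ α : ℝ → ℂ, Continuous α ∧
      α 0 = u ∧ α 1 = v ∧ InjOn α (Icc 0 1) ∧ (∀ t ∈ Ioo (0 : ℝ) 1, dist (α t) x < r) ∧
      (∃ a ∈ Icc (0 : ℝ) 1, α a = y) ∧ ∃ b ∈ Icc (0 : ℝ) 1, α b = H^[n] y := by
    rcases eq_or_ne y (H^[n] y) with heq | hne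
    · obtain ⟨z, hz, hzy⟩ : ∃ z, dist z x < min r (‖v - u‖ / 2) ∧ z ≠ y := by
        have : (Metric.ball x (min r (‖v - u‖ / 2))).Nontrivial :=
          (infinite_of_mem_nhds x (Metric.ball_mem_nhds x hδ)).nontrivial
        obtain ⟨z, hz, hzy⟩ := this.exists_ne y
        exact ⟨z, hz, hzy⟩
      obtain ⟨α, h1, h2, h3, h4, h5, h6, h7⟩ := key z y hzy hz hy
      exact ⟨α, h1, h2, h3, h4, h5, h7, heq ▸ h7⟩
    · exact key y _ hne hy hy'
  have hle : ∀ t ∈ Icc (0 : ℝ) 1, dist (α t) x ≤ r := by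
    rintro t ⟨ht0, ht1⟩
    rcases ht0.eq_or_lt with rfl | ht0
    · rw [h2, hu]
    rcases ht1.eq_or_lt with rfl | ht1
    · rw [h3, hv]
    exact (h5 t ⟨ht0, ht1⟩).le
  refine h.iterate_translation_arc_ne hfix h1 (by rw [h2, h3, hvdef]) h4 (fun s hs t ht heq ↦ ?_)
    ha hb hn (by rw [hay, hby])
  exact (hle t ht).not_gt (heq ▸ hfree _ (h5 s hs))

/-! ### Winding and the topology of the strip -/

/-- Homotopic loops in the punctured plane have the same winding. -/
theorem winding_eq_of_homotopy {g : ℝ → ℝ → ℂ} (hg : Continuous fun p : ℝ × ℝ ↦ g p.1 p.2)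
    (h0 : ∀ s t, g s t ≠ 0) (hloop : ∀ s, g s 1 = g s 0) {a b : ℝ → ℂ} (ha : Continuous a)
    (hb : Continuous b) (hag : ∀ t, Complex.exp (a t) = g 0 t)
    (hbg : ∀ t, Complex.exp (b t) = g 1 t) : a 1 - a 0 = b 1 - b 0 := by
  obtain ⟨l, hl, hexp⟩ := exists_continuous_log hg (fun p ↦ h0 p.1 p.2)
  have h1 := eq_of_exp_eq_const (u := fun s ↦ l (s, 1) - l (s, 0)) (by fun_prop) (c := 1)
    (fun s ↦ by rw [Complex.exp_sub, hexp, hexp, hloop, div_self (h0 _ _)]) 0 1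
  have h2 := eq_of_exp_eq_const (u := fun t ↦ l (0, t) - a t) (by fun_prop) (c := 1)
    (fun s ↦ by rw [Complex.exp_sub, hexp, hag, div_self (h0 _ _)]) 0 1
  have h3 := eq_of_exp_eq_const (u := fun t ↦ l (1, t) - b t) (by fun_prop) (c := 1)
    (fun s ↦ by rw [Complex.exp_sub, hexp, hbg, div_self (h0 _ _)]) 0 1
  linear_combination h1 + h2 - h3

/-- In a strip, a curve joining the two boundary lines meets every interior curve which is
invariant under a translation. -/
theorem exists_exp_eq_of_crossing {k : ℝ} (hk : 0 < k) {γ c : ℝ → ℂ} (hγ : Continuous γ)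
    (hc : Continuous c) (hγk : γ 1 = γ 0 + k) (hlow : ∀ t, -1 < (γ t).im)
    (hup : ∀ t, (γ t).im < 1) (hc0 : (c 0).im = -1) (hc1 : (c 1).im = 1) :
    ∃ s t, Complex.exp (2 * Real.pi * Complex.I / k * γ t) =
      Complex.exp (2 * Real.pi * Complex.I / k * c s) := by
  by_contra! hne
  have hk' : (k : ℂ) ≠ 0 := by exact_mod_cast hk.ne'
  obtain ⟨ω, hω⟩ : ∃ ω : ℂ, ω = 2 * Real.pi * Complex.I / k := ⟨_, rfl⟩
  rw [← hω] at hne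
  have hωk : ω * k = 2 * Real.pi * Complex.I := by rw [hω]; field_simp
  have hre : ∀ z : ℂ, (ω * z).re = -(2 * Real.pi / k * z.im) := by
    intro z
    have : ω = ((2 * Real.pi / k : ℝ) : ℂ) * Complex.I := by rw [hω]; push_cast; ring
    rw [this]
    simp
  have hpos : 0 < 2 * Real.pi / k := by positivity
  have hslit : ∀ z w : ℂ, z.im < w.im → 1 - Complex.exp (ω * w - ω * z) ∈ Complex.slitPlane := by
    intro z w hzw
    have hlt : ‖Complex.exp (ω * w - ω * z)‖ < 1 := by
      rw [Complex.norm_exp, Complex.sub_re, hre, hre, Real.exp_lt_one_iff]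
      nlinarith
    have := Complex.mem_slitPlane_of_norm_lt_one (z := -Complex.exp (ω * w - ω * z))
      (by rwa [norm_neg])
    rwa [← sub_eq_add_neg] at this
  have hexpk : Complex.exp (ω * γ 1) = Complex.exp (ω * γ 0) := by
    rw [hγk, mul_add, Complex.exp_add, hωk, Complex.exp_two_pi_mul_I, mul_one]
  have h0 : ∀ t, (c 0).im < (γ t).im := fun t ↦ hc0.trans_lt (hlow t)
  have h1 : ∀ t, (γ t).im < (c 1).im := fun t ↦ (hup t).trans_eq hc1.symm
  have := winding_eq_of_homotopy
    (g := fun s t ↦ Complex.exp (ω * γ t) - Complex.exp (ω * c s)) (by fun_prop)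
    (fun s t ↦ sub_ne_zero.2 (hne s t)) (fun s ↦ by rw [hexpk])
    (a := fun t ↦ ω * c 0 + Real.pi * Complex.I + Complex.log (1 - Complex.exp (ω * γ t - ω * c 0)))
    (b := fun t ↦ ω * γ t + Complex.log (1 - Complex.exp (ω * c 1 - ω * γ t)))
    (continuous_const.add (Continuous.clog (by fun_prop) fun t ↦ hslit _ _ (h0 t)))
    ((by fun_prop : Continuous fun t ↦ ω * γ t).add
      (Continuous.clog (by fun_prop) fun t ↦ hslit _ _ (h1 t)))
    (fun t ↦ by
      rw [Complex.exp_add, Complex.exp_add, Complex.exp_pi_mul_I,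
        Complex.exp_log (Complex.slitPlane_ne_zero (hslit _ _ (h0 t))), Complex.exp_sub]
      field_simp
      ring)
    (fun t ↦ by
      rw [Complex.exp_add, Complex.exp_log (Complex.slitPlane_ne_zero (hslit _ _ (h1 t))),
        Complex.exp_sub]
      field_simp)
  simp only [Complex.exp_sub, hexpk] at this
  rw [hγk, mul_add, hωk] at this
  exact Complex.two_pi_I_ne_zero (by linear_combination -this)

/-- The interior of the strip. -/
def coverInt : Set AnnulusCover := {z | -1 < (z.2 : ℝ) ∧ (z.2 : ℝ) < 1}

/-- A homeomorphism of the closed strip preserves the interior. -/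
theorem apply_mem_coverInt (e : AnnulusCover ≃ₜ AnnulusCover) {p : AnnulusCover}
    (hp : p ∈ coverInt) : e p ∈ coverInt := by
  by_contra hq
  obtain ⟨q, hqdef⟩ : ∃ q, q = e p := ⟨_, rfl⟩
  rw [← hqdef] at hq
  have hq1 : |(q.2 : ℝ)| = 1 := by
    refine le_antisymm (abs_le.2 q.2.2) ?_
    by_contra! hlt
    exact hq (abs_lt.1 hlt)
  obtain ⟨r, hr, hr1, hr2⟩ : ∃ r : ℝ, 0 < r ∧ -1 ≤ p.2 - r ∧ p.2 + r ≤ 1 := by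
    refine ⟨min (p.2 + 1) (1 - p.2), lt_min (by linarith [hp.1]) (by linarith [hp.2]), ?_, ?_⟩
    · linarith [min_le_left ((p.2 : ℝ) + 1) (1 - p.2)]
    · linarith [min_le_right ((p.2 : ℝ) + 1) (1 - p.2)]
  let lam : ℝ → AnnulusCover := fun t ↦ (p.1 + r * Real.cos (2 * Real.pi * t),
    ⟨p.2 + r * Real.sin (2 * Real.pi * t), by
      constructor
      · nlinarith [Real.neg_one_le_sin (2 * Real.pi * t)]
      · nlinarith [Real.sin_le_one (2 * Real.pi * t)]⟩)
  have hlam : Continuous lam := by fun_prop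
  have hlam1 : lam 1 = lam 0 := by simp [lam]
  let cl : ℝ → ℝ := fun s ↦ max 0 (min 1 s)
  have hcl : Continuous cl := by fun_prop
  have hcl0 : ∀ s, 0 ≤ cl s := fun s ↦ le_max_left _ _
  have hcl1 : ∀ s, cl s ≤ 1 := fun s ↦ max_le zero_le_one (min_le_left _ _)
  let h : ℝ → ℝ → AnnulusCover := fun s t ↦
    ((1 - cl s) * (e (lam t)).1, ⟨(1 - cl s) * (e (lam t)).2, by
      have h1 := (e (lam t)).2.2.1
      have h2 := (e (lam t)).2.2.2
      have h3 := hcl0 s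
      have h4 := hcl1 s
      constructor <;> nlinarith⟩)
  have hh : Continuous fun x : ℝ × ℝ ↦ h x.1 x.2 := by fun_prop
  let J : AnnulusCover → ℂ := fun z ↦ z.1 + (z.2 : ℝ) * Complex.I
  have hJ : Continuous J := by fun_prop
  have hJinj : Function.Injective J := by
    intro z w hzw
    have h1 := congr_arg Complex.re hzw
    have h2 := congr_arg Complex.im hzw
    simp [J] at h1 h2
    exact Prod.ext h1 (Subtype.ext h2)
  have hJlam : ∀ t, J (lam t) - J p = r * Complex.exp (2 * Real.pi * t * Complex.I) := by
    intro t
    rw [Complex.exp_mul_I]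
    simp only [J, lam]
    push_cast
    ring
  have hlamp : ∀ t, lam t ≠ p := fun t ht ↦ by
    have := hJlam t
    rw [ht, sub_self] at this
    exact mul_ne_zero (by exact_mod_cast hr.ne') (Complex.exp_ne_zero _) this.symm
  have hhq : ∀ s t, h s t ≠ q := by
    intro s t heq
    have h2 : (1 - cl s) * ((e (lam t)).2 : ℝ) = q.2 := by
      rw [← heq]
    have h3 : (1 - cl s) * |((e (lam t)).2 : ℝ)| = 1 := by
      rw [← abs_of_nonneg (sub_nonneg.2 (hcl1 s)), ← abs_mul, h2, hq1]
    have h4 : |((e (lam t)).2 : ℝ)| ≤ 1 := abs_le.2 (e (lam t)).2.2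
    have h5 : cl s = 0 := le_antisymm (by nlinarith [hcl0 s, hcl1 s]) (hcl0 s)
    have h6 : h s t = e (lam t) := by
      refine Prod.ext ?_ (Subtype.ext ?_) <;> simp [h, h5]
    rw [h6, hqdef] at heq
    exact hlamp t (e.injective heq)
  have hlog : Complex.exp (Real.log r) = r := by
    rw [← Complex.ofReal_exp, Real.exp_log hr]
  have hne : ∀ s t, J (e.symm (h s t)) - J p ≠ 0 := fun s t heq ↦ by
    have := hJinj (sub_eq_zero.1 heq)
    exact hhq s t (by rw [hqdef, ← this, e.apply_symm_apply])
  have hend : ∀ t, h 1 t = h 1 0 := by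
    intro t
    refine Prod.ext ?_ (Subtype.ext ?_) <;> simp [h, cl]
  have := winding_eq_of_homotopy (g := fun s t ↦ J (e.symm (h s t)) - J p) (by fun_prop) hne
    (fun s ↦ by simp only [h, hlam1])
    (a := fun t ↦ Real.log r + 2 * Real.pi * t * Complex.I)
    (b := fun _ ↦ Complex.log (J (e.symm (h 1 0)) - J p)) (by fun_prop) (by fun_prop)
    (fun t ↦ by
      have : h 0 t = e (lam t) := by
        refine Prod.ext ?_ (Subtype.ext ?_) <;> simp [h, cl]
      simp only [this, e.symm_apply_apply, hJlam, Complex.exp_add, hlog])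
    (fun t ↦ by rw [Complex.exp_log (hne 1 0), hend t])
  simp at this

/-! ### Fixed points in the strip -/

theorem isOpen_coverInt : IsOpen coverInt :=
  (isOpen_lt (f := fun _ : AnnulusCover ↦ (-1 : ℝ)) (by fun_prop) (by fun_prop)).inter
    (isOpen_lt (g := fun _ : AnnulusCover ↦ (1 : ℝ)) (by fun_prop) (by fun_prop))

/-- If the square of a homeomorphism of the closed strip is non-wandering at an interior point,
then it has an interior fixed point. -/
theorem exists_fixed_of_nonwandering (e : AnnulusCover ≃ₜ AnnulusCover) {x : AnnulusCover}
    (hx : x ∈ coverInt) (hret : ∀ D : Set AnnulusCover, IsOpen D → x ∈ D →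
      ∃ z ∈ D, ∃ n ≠ 0, ((e * e) ^ n) z ∈ D) :
    ∃ z ∈ coverInt, (e * e) z = z := by
  let A : AnnulusCover → ℂ := fun z ↦ z.1 + ((z.2 / (1 - |(z.2 : ℝ)|) : ℝ) : ℂ) * Complex.I
  have habs : ∀ t : ℝ, |t / (1 + |t|)| < 1 := by
    intro t
    have := abs_nonneg t
    rw [abs_div, abs_of_pos (a := 1 + |t|) (by positivity), div_lt_one (by positivity)]
    linarith
  let B : ℂ → AnnulusCover := fun w ↦ (w.re, ⟨w.im / (1 + |w.im|), abs_le.1 (habs w.im).le⟩)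
  have hBint : ∀ w, B w ∈ coverInt := fun w ↦ abs_lt.1 (habs w.im)
  have hB : Continuous B := by
    refine Complex.continuous_re.prodMk (Continuous.subtype_mk ?_ _)
    exact Complex.continuous_im.div (by fun_prop) fun w ↦ by positivity
  have hA : ContinuousOn A coverInt := by
    have : ContinuousOn (fun z : AnnulusCover ↦ (z.2 : ℝ) / (1 - |(z.2 : ℝ)|)) coverInt :=
      ContinuousOn.div (by fun_prop) (by fun_prop) fun z hz ↦
        (sub_pos.2 (abs_lt.2 hz)).ne'
    fun_prop
  have hAB : ∀ w, A (B w) = w := by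
    intro w
    have h1 : 0 < 1 + |w.im| := by positivity
    have h2 : w.im / (1 + |w.im|) / (1 - |w.im / (1 + |w.im|)|) = w.im := by
      rw [abs_div, abs_of_pos h1]
      field_simp
      simp
    simp only [A, B, h2]
    exact Complex.re_add_im w
  have hBA : ∀ z ∈ coverInt, B (A z) = z := by
    intro z hz
    have h1 : 0 < 1 - |(z.2 : ℝ)| := sub_pos.2 (abs_lt.2 hz)
    have h2 : (z.2 : ℝ) / (1 - |(z.2 : ℝ)|) / (1 + |(z.2 : ℝ) / (1 - |(z.2 : ℝ)|)|) = z.2 := by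
      rw [abs_div, abs_of_pos h1]
      field_simp
      simp
    have hre : (A z).re = z.1 := by
      simp only [A, Complex.add_re, Complex.ofReal_re, Complex.re_ofReal_mul, Complex.I_re,
        mul_zero, add_zero]
    have him : (A z).im = z.2 / (1 - |(z.2 : ℝ)|) := by
      simp only [A, Complex.add_im, Complex.ofReal_im, Complex.im_ofReal_mul, Complex.I_im,
        mul_one, zero_add]
    refine Prod.ext hre (Subtype.ext ?_)
    simpa only [B, him] using h2
  let G : ℂ ≃ₜ ℂ :=
    { toFun := fun w ↦ A (e (B w))
      invFun := fun w ↦ A (e.symm (B w))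
      left_inv := fun w ↦ by
        beta_reduce
        rw [hBA _ (apply_mem_coverInt e (hBint w)), e.symm_apply_apply, hAB]
      right_inv := fun w ↦ by
        beta_reduce
        rw [hBA _ (apply_mem_coverInt e.symm (hBint w)), e.apply_symm_apply, hAB]
      continuous_toFun :=
        hA.comp_continuous (by fun_prop) fun w ↦ apply_mem_coverInt e (hBint w)
      continuous_invFun :=
        hA.comp_continuous (by fun_prop) fun w ↦ apply_mem_coverInt e.symm (hBint w) }
  have hG : ∀ w, B ((G * G) w) = (e * e) (B w) := by
    intro w
    have h1 : B (G w) = e (B w) := hBA _ (apply_mem_coverInt e (hBint w))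
    have h2 : B (G (G w)) = e (B (G w)) := hBA _ (apply_mem_coverInt e (hBint (G w)))
    rw [Homeomorph.mul_apply, Homeomorph.mul_apply, h2, h1]
  by_contra! hfix
  obtain ⟨M, hM⟩ := IsPairLift.exists_sq G
  obtain ⟨δ, hδ, hw⟩ := hM.exists_wandering_ball
    (fun w hw ↦ hfix (B w) (hBint w) (by rw [← hG, hw])) (A x)
  have hiter : ∀ n w, B ((G * G)^[n] w) = ((e * e) ^ n) (B w) := by
    intro n
    induction n with
    | zero => intro w; rfl
    | succ n ih =>
      intro w
      rw [Function.iterate_succ_apply, ih, hG, pow_succ, Homeomorph.mul_apply _ (e * e)]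
  obtain ⟨z, ⟨hz1, hz2⟩, n, hn, hzn1, hzn2⟩ := hret _
    (hA.isOpen_inter_preimage isOpen_coverInt Metric.isOpen_ball) ⟨hx, Metric.mem_ball_self hδ⟩
  refine hw n hn (A z) hz2 ?_
  rw [← hAB ((G * G)^[n] (A z)), hiter, hBA z hz1]
  exact hzn2

/-! ### Essential domains of the strip -/

theorem IsPreconnected.subset_of_disjoint_frontier {X : Type*} [TopologicalSpace X] {s E : Set X}
    (hs : IsPreconnected s) (hE : IsOpen E) (hd : Disjoint s (frontier E))
    (hne : (s ∩ E).Nonempty) : s ⊆ E := by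
  refine hs.subset_left_of_subset_union hE isClosed_closure.isOpen_compl
    (disjoint_compl_right.mono_left subset_closure) (fun x hx ↦ ?_) hne
  by_cases hxE : x ∈ E
  · exact Or.inl hxE
  · refine Or.inr fun hxc ↦ disjoint_left.1 hd hx ?_
    rw [hE.frontier_eq]
    exact ⟨hxc, hxE⟩

theorem IsOpen.frontier_connectedComponentIn_subset {X : Type*} [TopologicalSpace X]
    [LocallyConnectedSpace X] {F : Set X} (hF : IsOpen F) (x : X) :
    frontier (connectedComponentIn F x) ⊆ Fᶜ := by
  intro z hz hzF
  rw [hF.connectedComponentIn.frontier_eq] at hz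
  obtain ⟨w, hwz, hwx⟩ := mem_closure_iff.1 hz.1 _ hF.connectedComponentIn
    (mem_connectedComponentIn hzF)
  refine hz.2 ?_
  rw [connectedComponentIn_eq hwx, ← connectedComponentIn_eq hwz]
  exact mem_connectedComponentIn hzF

instance : LocallyPathConnectedSpace (Icc (-1 : ℝ) 1) := (convex_Icc _ _).locallyPathConnectedSpace

instance : ConnectedSpace (Icc (-1 : ℝ) 1) :=
  isConnected_iff_connectedSpace.1 (isConnected_Icc (by norm_num))

/-- The deck transformation `(x, y) ↦ (x + 1, y)`. -/
def coverShift : AnnulusCover ≃ₜ AnnulusCover :=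
  (Homeomorph.addRight (1 : ℝ)).prodCongr (Homeomorph.refl _)

theorem coverShift_zpow_apply (n : ℤ) (z : AnnulusCover) :
    (coverShift ^ n) z = (z.1 + n, z.2) := by
  have h1 : ∀ w : AnnulusCover, coverShift w = (w.1 + 1, w.2) := fun _ ↦ rfl
  induction n using Int.induction_on with
  | zero => simp
  | succ n ih =>
    rw [add_comm, zpow_add, zpow_one, Homeomorph.mul_apply, ih, h1]
    push_cast
    ring_nf
  | pred n ih =>
    apply coverShift.injective
    rw [← Homeomorph.mul_apply, ← zpow_one_add, add_sub_cancel, ih, h1]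
    push_cast
    ring_nf

/-- The subgroup of homeomorphisms preserving a set. -/
def setStabilizer {X : Type*} [TopologicalSpace X] (C : Set X) : Subgroup (X ≃ₜ X) where
  carrier := {e | e '' C = C}
  one_mem' := image_id C
  mul_mem' {a b} ha hb := by
    change (a ∘ b) '' C = C
    rw [image_comp, hb, ha]
  inv_mem' {a} ha := by
    change a.symm '' C = C
    conv_lhs => rw [← ha]
    rw [← image_comp, a.symm_comp_self, image_id]

theorem apply_mem_of_mem_setStabilizer {X : Type*} [TopologicalSpace X] {C : Set X} {e : X ≃ₜ X}
    (he : e ∈ setStabilizer C) {x : X} (hx : x ∈ C) : e x ∈ C :=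
  he.subset (mem_image_of_mem e hx)

theorem mem_setStabilizer_connectedComponentIn {X : Type*} [TopologicalSpace X] {W : Set X}
    {e : X ≃ₜ X} (he : e ∈ setStabilizer W) {p x : X} (hx : x ∈ connectedComponentIn W p)
    (hex : e x ∈ connectedComponentIn W p) : e ∈ setStabilizer (connectedComponentIn W p) := by
  change e '' _ = _
  have he' : e '' W = W := he
  rw [connectedComponentIn_eq hx,
    e.image_connectedComponentIn (connectedComponentIn_subset _ _ hx), he',
    ← connectedComponentIn_eq hex, connectedComponentIn_eq hx]

/-- An essential domain separates the two boundary lines of the strip. -/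
theorem exists_separation {C : Set AnnulusCover} (hC : IsOpen C) (hconn : IsConnected C)
    (hint : C ⊆ coverInt) {k : ℕ} (hk : k ≠ 0)
    (hshift : coverShift ^ (k : ℤ) ∈ setStabilizer C) :
    ∃ L R : Set AnnulusCover, IsOpen L ∧ IsOpen R ∧ IsPreconnected L ∧ IsPreconnected R ∧
      Disjoint L R ∧ (∀ z : AnnulusCover, (z.2 : ℝ) = -1 → z ∈ L) ∧
      (∀ z : AnnulusCover, (z.2 : ℝ) = 1 → z ∈ R) ∧ frontier L ⊆ C ∧ frontier R ⊆ C := by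
  have hk' : (0 : ℝ) < k := by exact_mod_cast Nat.pos_of_ne_zero hk
  let J : AnnulusCover → ℂ := fun z ↦ z.1 + (z.2 : ℝ) * Complex.I
  have hJ : Continuous J := by fun_prop
  have hJim : ∀ z, (J z).im = z.2 := fun z ↦ by simp [J]
  let P : AnnulusCover → ℂ := fun z ↦ Complex.exp (2 * Real.pi * Complex.I / (k : ℝ) * J z)
  have hP : Continuous P := by fun_prop
  obtain ⟨x, hx⟩ := hconn.nonempty
  obtain ⟨γ, hγ⟩ := (hC.isConnected_iff_isPathConnected.1 hconn).joinedIn x hx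
    _ (apply_mem_of_mem_setStabilizer hshift hx)
  let Γ : Set AnnulusCover := P ⁻¹' (P '' range γ)
  have hΓ : IsClosed Γ := ((isCompact_range γ.continuous).image hP).isClosed.preimage hP
  have hPn : ∀ z w, P z = P w → ∃ n : ℤ, z = (coverShift ^ (n * (k : ℤ))) w := by
    intro z w hzw
    obtain ⟨n, hn⟩ := Complex.exp_eq_exp_iff_exists_int.1 hzw
    refine ⟨n, ?_⟩
    have hn' : J z = J w + n * k := by
      have h2 : 2 * Real.pi * Complex.I / (k : ℝ) ≠ (0 : ℂ) :=
        div_ne_zero Complex.two_pi_I_ne_zero (by exact_mod_cast hk)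
      refine mul_left_cancel₀ h2 ?_
      rw [hn, mul_add]
      push_cast
      field_simp
      simp only [J]
      ring
    rw [coverShift_zpow_apply]
    refine Prod.ext ?_ (Subtype.ext ?_)
    · have := congr_arg Complex.re hn'
      simp [J] at this
      simpa using this
    · have := congr_arg Complex.im hn'
      simpa [J] using this
  have hΓC : Γ ⊆ C := by
    rintro z ⟨_, ⟨t, rfl⟩, ht⟩
    obtain ⟨n, rfl⟩ := hPn _ _ ht.symm
    rw [mul_comm, zpow_mul]
    exact apply_mem_of_mem_setStabilizer (zpow_mem hshift n) (hγ t)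
  have hline : ∀ y : Icc (-1 : ℝ) 1, (∀ x, ((x, y) : AnnulusCover) ∉ coverInt) →
      ∀ x, ((x, y) : AnnulusCover) ∈ connectedComponentIn Γᶜ (0, y) := by
    intro y hy x
    have h1 : IsPreconnected (range fun x : ℝ ↦ ((x, y) : AnnulusCover)) :=
      isPreconnected_range (by fun_prop)
    refine h1.subset_connectedComponentIn (mem_range_self 0) ?_ (mem_range_self x)
    rintro _ ⟨x, rfl⟩ hmem
    exact hy x (hint (hΓC hmem))
  obtain ⟨yb, hyb⟩ : ∃ y : Icc (-1 : ℝ) 1, (y : ℝ) = -1 := ⟨⟨-1, by norm_num⟩, rfl⟩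
  obtain ⟨yt, hyt⟩ : ∃ y : Icc (-1 : ℝ) 1, (y : ℝ) = 1 := ⟨⟨1, by norm_num⟩, rfl⟩
  have hb := hline yb (fun x h ↦ by linarith [h.1])
  have ht := hline yt (fun x h ↦ by linarith [h.2])
  refine ⟨connectedComponentIn Γᶜ (0, yb), connectedComponentIn Γᶜ (0, yt),
    hΓ.isOpen_compl.connectedComponentIn, hΓ.isOpen_compl.connectedComponentIn,
    isPreconnected_connectedComponentIn, isPreconnected_connectedComponentIn, ?_, ?_, ?_, ?_, ?_⟩
  · rw [disjoint_left]
    intro z hzb hzt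
    have hbt := (connectedComponentIn_eq hzb).trans (connectedComponentIn_eq hzt).symm
    have hpc := (hΓ.isOpen_compl.connectedComponentIn (x := ((0, yb) : AnnulusCover))
      |>.isConnected_iff_isPathConnected).1 ⟨⟨_, hb 0⟩, isPreconnected_connectedComponentIn⟩
    obtain ⟨c, hc⟩ := hpc.joinedIn _ (hb 0) _ (hbt ▸ ht 0)
    have hγ0 : ∀ t, γ.extend t ∈ C := fun t ↦ hγ _
    obtain ⟨s, t, hst⟩ := exists_exp_eq_of_crossing hk' (γ := fun t ↦ J (γ.extend t))
      (c := fun t ↦ J (c.extend t)) (by fun_prop) (by fun_prop)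
      (by
        simp only [γ.extend_one, γ.extend_zero, coverShift_zpow_apply, J]
        push_cast
        ring)
      (fun t ↦ by rw [hJim]; exact (hint (hγ0 t)).1)
      (fun t ↦ by rw [hJim]; exact (hint (hγ0 t)).2)
      (by simpa [J] using hyb) (by simpa [J] using hyt)
    exact connectedComponentIn_subset _ _ (hc _) ⟨_, ⟨_, rfl⟩, hst⟩
  · rintro ⟨x, y⟩ hy
    obtain rfl : y = yb := Subtype.ext (hy.trans hyb.symm)
    exact hb x
  · rintro ⟨x, y⟩ hy
    obtain rfl : y = yt := Subtype.ext (hy.trans hyt.symm)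
    exact ht x
  · exact (hΓ.isOpen_compl.frontier_connectedComponentIn_subset _).trans (by rwa [compl_compl])
  · exact (hΓ.isOpen_compl.frontier_connectedComponentIn_subset _).trans (by rwa [compl_compl])

/-- The hypotheses of a separation between two disjoint domains on the same side are
contradictory. -/
theorem false_of_same_side {X : Type*} [TopologicalSpace X] [PreconnectedSpace X]
    {U V E F : Set X} (hUV : Disjoint U V) (hE : IsOpen E) (hF : IsOpen F)
    (hEc : IsPreconnected E) (hFc : IsPreconnected F) (hEU : frontier E ⊆ U)
    (hFV : frontier F ⊆ V) (hVE : Disjoint V E) (hUF : Disjoint U F) (hne : (E ∩ F).Nonempty)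
    (huniv : E ≠ univ) : False := by
  have h1 := hEc.subset_of_disjoint_frontier hF (hVE.symm.mono_right hFV) hne
  have h2 := hFc.subset_of_disjoint_frontier hE (hUF.symm.mono_right hEU) (by rwa [inter_comm])
  obtain rfl := h1.antisymm h2
  obtain ⟨x, hx⟩ := nonempty_frontier_iff.2 ⟨hne.mono inter_subset_left, huniv⟩
  exact disjoint_left.1 hUV (hEU hx) (hFV hx)

/-- A connected set disjoint from a domain lies off one of the two sides of it. -/
theorem disjoint_or_disjoint_of_separation {X : Type*} [TopologicalSpace X]
    {U V L R : Set X} (hUV : Disjoint U V) (hV : IsConnected V) (hL : IsOpen L)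
    (hLR : Disjoint L R) (hLU : frontier L ⊆ U) : Disjoint V L ∨ Disjoint V R := by
  by_contra! h
  have h1 := hV.isPreconnected.subset_of_disjoint_frontier hL (hUV.symm.mono_right hLU)
    (not_disjoint_iff_nonempty_inter.1 h.1)
  exact h.2 (hLR.mono_left h1)

theorem exists_invariant_frontier_of_sides {U V L R : Set AnnulusCover}
    (hUne : U.Nonempty) (hV : IsOpen V) (hVc : IsConnected V) (hUV : Disjoint U V) (hL : IsOpen L)
    (hR : IsOpen R) (hLb : ∀ z : AnnulusCover, (z.2 : ℝ) = -1 → z ∈ L)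
    (hRt : ∀ z : AnnulusCover, (z.2 : ℝ) = 1 → z ∈ R) (hLU : frontier L ⊆ U)
    (hVL : Disjoint V L) (hUR : Disjoint U R) :
    ∃ K : Set AnnulusCover, IsClosed K ∧ K.Nonempty ∧ K ⊆ coverInt ∧
      ∀ e, e ∈ setStabilizer U → e ∈ setStabilizer V → e ∈ setStabilizer K := by
  obtain ⟨v, hv⟩ := hVc.nonempty
  obtain ⟨F, hFdef⟩ : ∃ F, F = (closure U)ᶜ := ⟨_, rfl⟩
  have hF : IsOpen F := hFdef ▸ isClosed_closure.isOpen_compl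
  have hVF : V ⊆ F := by
    rw [hFdef, subset_compl_iff_disjoint_right]
    exact (hUV.closure_left hV).symm
  have hvO := mem_connectedComponentIn (hVF hv)
  have hFr : frontier (connectedComponentIn F v) ⊆ closure U := by
    simpa [hFdef] using hF.frontier_connectedComponentIn_subset v
  have hOU : Disjoint (connectedComponentIn F v) (closure U) :=
    disjoint_compl_left.mono_left ((connectedComponentIn_subset _ _).trans_eq hFdef)
  have hOL : Disjoint (connectedComponentIn F v) L := by
    by_contra h
    have := isPreconnected_connectedComponentIn.subset_of_disjoint_frontier hL
      (hOU.mono_right (hLU.trans subset_closure)) (not_disjoint_iff_nonempty_inter.1 h)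
    exact disjoint_left.1 hVL hv (this hvO)
  refine ⟨frontier (connectedComponentIn F v), isClosed_frontier,
    nonempty_frontier_iff.2 ⟨⟨v, hvO⟩, fun h ↦ ?_⟩, fun z hz ↦ ⟨?_, ?_⟩, fun e heU heV ↦ ?_⟩
  · obtain ⟨u, hu⟩ := hUne
    exact disjoint_left.1 hOU (h ▸ mem_univ u) (subset_closure hu)
  · refine z.2.2.1.lt_of_ne fun h ↦ ?_
    exact disjoint_left.1 (hOL.closure_left hL) (frontier_subset_closure hz) (hLb z h.symm)
  · refine z.2.2.2.lt_of_ne fun h ↦ ?_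
    exact disjoint_left.1 (hUR.closure_left hR) (hFr hz) (hRt z h)
  · have heF : e ∈ setStabilizer F := by
      change e '' F = F
      have heU' : e '' U = U := heU
      rw [hFdef, image_compl_eq e.bijective, e.image_closure, heU']
    have hVO := hVc.isPreconnected.subset_connectedComponentIn hv hVF
    have heO : e '' _ = _ := mem_setStabilizer_connectedComponentIn heF hvO
      (hVO (apply_mem_of_mem_setStabilizer heV hv))
    change e '' _ = _
    rw [e.image_frontier, heO]

/-- Two disjoint essential domains of the strip are separated by a closed set, invariant under the
homeomorphisms which preserve both. -/
theorem exists_invariant_frontier {U V : Set AnnulusCover} (hU : IsOpen U) (hUc : IsConnected U)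
    (hUint : U ⊆ coverInt) (hV : IsOpen V) (hVc : IsConnected V) (hVint : V ⊆ coverInt)
    (hUV : Disjoint U V) {k : ℕ} (hk : k ≠ 0) (hkU : coverShift ^ (k : ℤ) ∈ setStabilizer U)
    (hkV : coverShift ^ (k : ℤ) ∈ setStabilizer V) :
    ∃ K : Set AnnulusCover, IsClosed K ∧ K.Nonempty ∧ K ⊆ coverInt ∧
      ∀ e, e ∈ setStabilizer U → e ∈ setStabilizer V → e ∈ setStabilizer K := by
  obtain ⟨L, R, hL, hR, hLc, hRc, hLR, hLb, hRt, hLU, hRU⟩ :=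
    exists_separation hU hUc hUint hk hkU
  obtain ⟨L', R', hL', hR', hLc', hRc', hLR', hLb', hRt', hLV, hRV⟩ :=
    exists_separation hV hVc hVint hk hkV
  have hbot : ((0, ⟨-1, by norm_num⟩) : AnnulusCover) ∈ L ∩ L' := ⟨hLb _ rfl, hLb' _ rfl⟩
  have htop : ((0, ⟨1, by norm_num⟩) : AnnulusCover) ∈ R ∩ R' := ⟨hRt _ rfl, hRt' _ rfl⟩
  rcases disjoint_or_disjoint_of_separation hUV hVc hL hLR hLU with h1 | h1 <;>
  rcases disjoint_or_disjoint_of_separation hUV.symm hUc hL' hLR' hLV with h2 | h2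
  · exact (false_of_same_side hUV hL hL' hLc hLc' hLU hLV h1 h2 ⟨_, hbot⟩ fun h ↦
      disjoint_left.1 hLR (h ▸ mem_univ _) htop.1).elim
  · exact exists_invariant_frontier_of_sides hUc.nonempty hV hVc hUV hL hR' hLb hRt' hLU h1 h2
  · obtain ⟨K, h3, h4, h5, h6⟩ := exists_invariant_frontier_of_sides hVc.nonempty hU hUc
      hUV.symm hL' hR hLb' hRt hLV h2 h1
    exact ⟨K, h3, h4, h5, fun e he he' ↦ h6 e he' he⟩
  · exact (false_of_same_side hUV hR hR' hRc hRc' hRU hRV h1 h2 ⟨_, htop⟩ fun h ↦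
      disjoint_left.1 hLR hbot.1 (h ▸ mem_univ _)).elim

/-! ### Recurrence and the main theorem -/

instance : Measure.IsOpenPosMeasure (volume : Measure (Icc (-1 : ℝ) 1)) where
  open_pos := by
    rintro _ ⟨O, hO, rfl⟩ ⟨y, hy⟩
    have hcl : (y : ℝ) ∈ closure (Ioo (-1 : ℝ) 1) := by
      rw [closure_Ioo (by norm_num)]
      exact y.2
    have hpos := (hO.inter isOpen_Ioo).measure_pos volume (mem_closure_iff.1 hcl O hO hy)
    rw [Measure.Subtype.volume_def, comap_subtype_coe_apply measurableSet_Icc]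
    refine (hpos.trans_le (measure_mono ?_)).ne'
    exact fun x hx ↦ ⟨⟨x, Ioo_subset_Icc_self hx.2⟩, hx.1, rfl⟩

instance : IsFiniteMeasure (volume : Measure (Icc (-1 : ℝ) 1)) where
  measure_univ_lt_top := by
    rw [Measure.Subtype.volume_univ measurableSet_Icc.nullMeasurableSet]
    exact measure_Icc_lt_top

theorem isOpenMap_annulusProj : IsOpenMap annulusProj :=
  (QuotientAddGroup.isOpenMap_coe).prodMap IsOpenMap.id

theorem continuous_annulusProj : Continuous annulusProj := by
  refine Continuous.prodMk ?_ continuous_snd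
  exact (AddCircle.continuous_mk' (1 : ℝ)).comp continuous_fst

theorem surjective_annulusProj : Function.Surjective annulusProj := by
  rintro ⟨x, y⟩
  obtain ⟨x, rfl⟩ := QuotientAddGroup.mk_surjective x
  exact ⟨(x, y), rfl⟩

theorem annulusProj_eq_iff {z w : AnnulusCover} :
    annulusProj z = annulusProj w ↔ ∃ n : ℤ, w = (coverShift ^ n) z := by
  simp only [annulusProj, coverShift_zpow_apply, Prod.ext_iff]
  constructor
  · rintro ⟨h1, h2⟩
    obtain ⟨n, hn⟩ := (AddCircle.coe_eq_zero_iff (1 : ℝ) (x := w.1 - z.1)).1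
      (by rw [AddCircle.coe_sub, h1, sub_self])
    refine ⟨n, ?_, h2.symm⟩
    rw [zsmul_one] at hn
    linarith
  · rintro ⟨n, h1, h2⟩
    refine ⟨?_, h2.symm⟩
    rw [h1, AddCircle.coe_add, (AddCircle.coe_eq_zero_iff (1 : ℝ)).2 ⟨n, zsmul_one n⟩, add_zero]

namespace IsLift
variable {f : Annulus ≃ₜ Annulus} {ft : AnnulusCover ≃ₜ AnnulusCover}

theorem commute (h : IsLift f ft) : Commute coverShift ft := by
  ext1 z
  exact (h.1 z).symm

theorem pow_apply (h : IsLift f ft) (n : ℕ) (z : AnnulusCover) :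
    (f ^ n) (annulusProj z) = annulusProj ((ft ^ n) z) := by
  induction n with
  | zero => rfl
  | succ n ih => rw [pow_succ', pow_succ', Homeomorph.mul_apply, ih, h.2, Homeomorph.mul_apply]

/-- Poincaré recurrence, upstairs. -/
theorem exists_return (h : IsLift f ft) (harea : MeasurePreserving f volume volume)
    {D : Set AnnulusCover} (hD : IsOpen D) (hne : D.Nonempty) (n : ℕ) :
    ∃ z ∈ D, ∃ j ≠ 0, ∃ k : ℤ, (coverShift ^ k) ((ft ^ (n * j)) z) ∈ D := by
  have : IsFiniteMeasure (volume : Measure Annulus) :=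
    inferInstanceAs (IsFiniteMeasure (Measure.prod volume volume))
  have : Measure.IsOpenPosMeasure (volume : Measure Annulus) :=
    inferInstanceAs (Measure.IsOpenPosMeasure (Measure.prod volume volume))
  obtain ⟨_, ⟨z, hz, rfl⟩, j, hj, w, hw, hwz⟩ :=
    (harea.iterate n).conservative.exists_mem_iterate_mem
      (isOpenMap_annulusProj D hD).measurableSet.nullMeasurableSet
      ((isOpenMap_annulusProj D hD).measure_ne_zero volume (hne.image _))
  have hit : ∀ m, f^[m] = ⇑(f ^ m) := by
    intro m
    induction m with
    | zero => rfl
    | succ m ih =>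
      rw [Function.iterate_succ, ih, pow_succ]
      rfl
  rw [← Function.iterate_mul, hit, h.pow_apply] at hwz
  obtain ⟨k, hk⟩ := annulusProj_eq_iff.1 hwz.symm
  exact ⟨z, hz, j, hj, k, hk ▸ hw⟩

theorem mem_setStabilizer_preimage (h : IsLift f ft) {A : Set Annulus} (hA : f '' A = A) :
    ft ∈ setStabilizer (annulusProj ⁻¹' A) := by
  change ft '' _ = _
  ext z
  constructor
  · rintro ⟨w, hw, rfl⟩
    rw [mem_preimage, ← h.2, ← hA]
    exact mem_image_of_mem f hw
  · intro hz
    refine ⟨ft.symm z, ?_, ft.apply_symm_apply z⟩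
    rwa [mem_preimage, ← ft.apply_symm_apply z, ← h.2, ← hA, f.injective.mem_set_image] at hz

theorem image_annulusInt (h : IsLift f ft) : f '' annulusInt = annulusInt := by
  ext x
  obtain ⟨z, rfl⟩ := surjective_annulusProj x
  constructor
  · rintro ⟨y, hy, hyz⟩
    obtain ⟨w, rfl⟩ := surjective_annulusProj y
    rw [← hyz, h.2]
    exact apply_mem_coverInt ft hy
  · intro hz
    refine ⟨annulusProj (ft.symm z), apply_mem_coverInt ft.symm hz, ?_⟩
    rw [h.2, ft.apply_symm_apply]

/-- Without compact invariant sets in the interior, there are none for the iterates either. -/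
theorem false_of_periodic (h : IsLift f ft) (hnicis : NICIS f) {K : Set Annulus}
    (hne : K.Nonempty) (hK : IsCompact K) (hint : K ⊆ annulusInt) {m : ℕ} (hm : m ≠ 0)
    (hinv : (f ^ m) '' K = K) : False := by
  have hsucc : ∀ i, f '' (⇑(f ^ i) '' K) = ⇑(f ^ (i + 1)) '' K := by
    intro i
    rw [image_image, pow_succ']
    rfl
  have hpint : ∀ i, ⇑(f ^ i) '' K ⊆ annulusInt := by
    intro i
    induction i with
    | zero => rintro _ ⟨x, hx, rfl⟩; exact hint hx
    | succ i ih =>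
      rw [← hsucc]
      exact (image_mono ih).trans_eq h.image_annulusInt
  have hzero : ⇑(f ^ 0) '' K = K := image_id K
  refine hnicis ⟨⋃ i ∈ Finset.range m, ⇑(f ^ i) '' K, ?_, ?_, ?_, ?_⟩
  · obtain ⟨x, hx⟩ := hne
    exact ⟨x, mem_biUnion (Finset.mem_coe.2 (Finset.mem_range.2 (Nat.pos_of_ne_zero hm)))
      (hzero.symm ▸ hx)⟩
  · exact (Finset.range m).isCompact_biUnion fun i _ ↦ hK.image (f ^ i).continuous
  · simp only [image_iUnion, hsucc]
    refine Subset.antisymm ?_ ?_ <;> refine iUnion₂_subset fun i hi ↦ ?_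
    · rw [Finset.mem_range] at hi
      rcases (Nat.succ_le_of_lt hi).eq_or_lt with heq | hlt
      · rw [show i + 1 = m from heq, hinv]
        refine hzero.symm.subset.trans ?_
        exact subset_biUnion_of_mem (u := fun i ↦ ⇑(f ^ i) '' K)
          (Finset.mem_coe.2 (Finset.mem_range.2 (Nat.pos_of_ne_zero hm)))
      · exact subset_biUnion_of_mem (u := fun i ↦ ⇑(f ^ i) '' K)
          (Finset.mem_coe.2 (Finset.mem_range.2 hlt))
    · rw [Finset.mem_range] at hi
      rcases i with _ | i
      · rw [hzero]
        obtain ⟨n, rfl⟩ := Nat.exists_eq_succ_of_ne_zero hm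
        refine hinv.symm.subset.trans ?_
        exact subset_biUnion_of_mem (u := fun i ↦ ⇑(f ^ (i + 1)) '' K)
          (Finset.mem_coe.2 (Finset.mem_range.2 n.lt_succ_self))
      · exact subset_biUnion_of_mem (u := fun i ↦ ⇑(f ^ (i + 1)) '' K)
          (Finset.mem_coe.2 (Finset.mem_range.2 (i.lt_succ_self.trans hi)))
  · exact iUnion₂_subset fun i _ ↦ hpint i

/-- Without compact invariant sets in the interior, the components of the preimage of an
invariant open set are essential and periodic. -/
theorem exists_pow_mem_setStabilizer (h : IsLift f ft)
    (harea : MeasurePreserving f volume volume) (hnicis : NICIS f) {W : Set AnnulusCover}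
    (hW : IsOpen W) (hint : W ⊆ coverInt) (hshift : coverShift ∈ setStabilizer W)
    (hft : ft ∈ setStabilizer W) {p : AnnulusCover} (hp : p ∈ W) :
    ∃ m ≠ 0, ∃ k ≠ 0, ft ^ m ∈ setStabilizer (connectedComponentIn W p) ∧
      coverShift ^ k ∈ setStabilizer (connectedComponentIn W p) := by
  have hC := hW.connectedComponentIn (x := p)
  have hpC := mem_connectedComponentIn hp
  obtain ⟨z, hz, j, hj, k, hk⟩ := h.exists_return harea hC ⟨p, hpC⟩ 1
  rw [one_mul] at hk
  have hg : coverShift ^ k * ft ^ j ∈ setStabilizer (connectedComponentIn W p) :=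
    mem_setStabilizer_connectedComponentIn (mul_mem (zpow_mem hshift k) (pow_mem hft j)) hz hk
  have hcomm : Commute (coverShift ^ k) (ft ^ j) :=
    Commute.pow_right (Commute.zpow_left h.commute k) j
  have hnatAbs : ∀ (S : Subgroup (AnnulusCover ≃ₜ AnnulusCover)) (e : AnnulusCover ≃ₜ AnnulusCover)
      (n : ℤ), e ^ n ∈ S → e ^ n.natAbs ∈ S := by
    intro S e n hn
    rcases n.natAbs_eq with heq | heq
    · rwa [heq, zpow_natCast] at hn
    · rwa [heq, zpow_neg, inv_mem_iff, zpow_natCast] at hn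
  by_cases hess : ∃ l : ℤ, l ≠ 0 ∧ coverShift ^ l ∈ setStabilizer (connectedComponentIn W p)
  · obtain ⟨l, hl, hlC⟩ := hess
    refine ⟨j * l.natAbs, mul_ne_zero hj (Int.natAbs_ne_zero.2 hl), l.natAbs,
      Int.natAbs_ne_zero.2 hl, ?_, hnatAbs _ _ _ hlC⟩
    rw [pow_mul]
    refine hnatAbs _ _ _ ?_
    have h1 := zpow_mem hg l
    rw [hcomm.mul_zpow, ← zpow_mul, mul_comm, zpow_mul] at h1
    exact (Subgroup.mul_mem_cancel_left _ (zpow_mem hlC k)).1 h1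
  · exfalso
    push Not at hess
    have hsq : (coverShift ^ k * ft ^ j) * (coverShift ^ k * ft ^ j) =
        coverShift ^ (k + k) * ft ^ (j + j) := by
      rw [← sq, hcomm.mul_pow, sq, sq, ← zpow_add, ← pow_add]
    obtain ⟨y, hy, hfix⟩ := exists_fixed_of_nonwandering (coverShift ^ k * ft ^ j) (hint hp)
      fun D hD hpD ↦ by
        obtain ⟨z, hz, i, hi, l, hl⟩ := h.exists_return harea (hD.inter hC) ⟨p, hpD, hpC⟩ (j + j)
        refine ⟨z, hz.1, i, hi, ?_⟩
        have hgi := pow_mem (mul_mem hg hg) i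
        have heq : coverShift ^ l * ft ^ ((j + j) * i) = coverShift ^ (l - (k + k) * i) *
            ((coverShift ^ k * ft ^ j) * (coverShift ^ k * ft ^ j)) ^ i := by
          rw [hsq, (Commute.pow_right (Commute.zpow_left h.commute (k + k)) (j + j)).mul_pow,
            ← zpow_natCast (coverShift ^ (k + k)), ← zpow_mul, ← pow_mul,
            ← mul_assoc, ← zpow_add, sub_add_cancel]
        rw [← Homeomorph.mul_apply, heq, Homeomorph.mul_apply] at hl
        have hl0 : l - (k + k) * i = 0 := by
          by_contra hne
          exact hess _ hne (mem_setStabilizer_connectedComponentIn (zpow_mem hshift _)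
            (apply_mem_of_mem_setStabilizer hgi hz.2) hl.2)
        rw [hl0, zpow_zero] at hl
        exact hl.1
    rw [hsq, Homeomorph.mul_apply] at hfix
    refine h.false_of_periodic hnicis (singleton_nonempty (annulusProj y)) isCompact_singleton
      (singleton_subset_iff.2 hy) (m := j + j) (by omega) ?_
    rw [image_singleton, h.pow_apply, annulusProj_eq_iff.2 ⟨k + k, hfix.symm⟩]

end IsLift

theorem isLift_one_coverShift : IsLift 1 coverShift :=
  ⟨fun _ ↦ rfl, fun z ↦ annulusProj_eq_iff.2 ⟨1, by rw [zpow_one]⟩⟩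

/-- Every nonempty invariant open subset of the interior is dense in the interior, for a NICIS
homeomorphism. -/
theorem stmt_4 (f : Annulus ≃ₜ Annulus) (ft : AnnulusCover ≃ₜ AnnulusCover)
    (harea : MeasurePreserving f volume volume)
    (hlift : IsLift f ft) (hnicis : NICIS f)
    (U : Set Annulus) (hUopen : IsOpen U) (hUne : U.Nonempty)
    (hUsub : U ⊆ annulusInt) (hUinv : f '' U = U) :
    annulusInt ⊆ closure U := by
  intro y hy
  by_contra hyU
  have hVinv : f '' (annulusInt \ closure U) = annulusInt \ closure U := by
    rw [image_sdiff f.injective, hlift.image_annulusInt, f.image_closure, hUinv]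
  obtain ⟨x, hx⟩ := hUne
  obtain ⟨p, rfl⟩ := surjective_annulusProj x
  obtain ⟨q, rfl⟩ := surjective_annulusProj y
  obtain ⟨A, hA⟩ : ∃ A, A = annulusProj ⁻¹' U := ⟨_, rfl⟩
  obtain ⟨B, hB⟩ : ∃ B, B = annulusProj ⁻¹' (annulusInt \ closure U) := ⟨_, rfl⟩
  have hpA : p ∈ A := hA ▸ hx
  have hqB : q ∈ B := hB ▸ ⟨hy, hyU⟩
  have hAo : IsOpen A := hA ▸ hUopen.preimage continuous_annulusProj
  have hBo : IsOpen B := by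
    rw [hB, preimage_sdiff]
    exact isOpen_coverInt.sdiff (isClosed_closure.preimage continuous_annulusProj)
  have hAint : A ⊆ coverInt := hA ▸ fun z hz ↦ hUsub hz
  have hBint : B ⊆ coverInt := hB ▸ fun z hz ↦ hz.1
  have hAB : Disjoint A B := by
    rw [hA, hB, disjoint_left]
    exact fun z hz hz' ↦ hz'.2 (subset_closure hz)
  obtain ⟨m, hm, k, hk, hmA, hkA⟩ := hlift.exists_pow_mem_setStabilizer harea hnicis hAo hAint
    (hA ▸ isLift_one_coverShift.mem_setStabilizer_preimage (image_id U))
    (hA ▸ hlift.mem_setStabilizer_preimage hUinv) hpA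
  obtain ⟨n, hn, l, hl, hnB, hlB⟩ := hlift.exists_pow_mem_setStabilizer harea hnicis hBo hBint
    (hB ▸ isLift_one_coverShift.mem_setStabilizer_preimage (image_id _))
    (hB ▸ hlift.mem_setStabilizer_preimage hVinv) hqB
  have hklA : coverShift ^ ((k * l : ℕ) : ℤ) ∈ setStabilizer (connectedComponentIn A p) := by
    rw [zpow_natCast, pow_mul]
    exact pow_mem hkA l
  have hklB : coverShift ^ ((k * l : ℕ) : ℤ) ∈ setStabilizer (connectedComponentIn B q) := by
    rw [zpow_natCast, mul_comm, pow_mul]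
    exact pow_mem hlB k
  have hmnA : ft ^ (m * n) ∈ setStabilizer (connectedComponentIn A p) := by
    rw [pow_mul]
    exact pow_mem hmA n
  have hmnB : ft ^ (m * n) ∈ setStabilizer (connectedComponentIn B q) := by
    rw [mul_comm, pow_mul]
    exact pow_mem hnB m
  obtain ⟨K, hK, hKne, hKint, hKinv⟩ := exists_invariant_frontier hAo.connectedComponentIn
    ⟨⟨p, mem_connectedComponentIn hpA⟩, isPreconnected_connectedComponentIn⟩
    ((connectedComponentIn_subset _ _).trans hAint) hBo.connectedComponentIn
    ⟨⟨q, mem_connectedComponentIn hqB⟩, isPreconnected_connectedComponentIn⟩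
    ((connectedComponentIn_subset _ _).trans hBint)
    (hAB.mono (connectedComponentIn_subset _ _) (connectedComponentIn_subset _ _))
    (mul_ne_zero hk hl) hklA hklB
  have hKshift := hKinv _ hklA hklB
  have hKft : (ft ^ (m * n)) '' K = K := hKinv _ hmnA hmnB
  have hkl : (0 : ℝ) < (k * l : ℕ) := by exact_mod_cast Nat.pos_of_ne_zero (mul_ne_zero hk hl)
  have hcompact : annulusProj '' K =
      annulusProj '' (K ∩ Icc (0 : ℝ) (k * l : ℕ) ×ˢ univ) := by
    refine Subset.antisymm ?_ (image_mono inter_subset_left)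
    rintro _ ⟨z, hz, rfl⟩
    obtain ⟨i, hi, -⟩ := existsUnique_add_zsmul_mem_Ico hkl z.1 0
    have hshift : (coverShift ^ (((k * l : ℕ) : ℤ) * i)) z ∈ K := by
      rw [zpow_mul]
      exact apply_mem_of_mem_setStabilizer (zpow_mem hKshift i) hz
    refine ⟨_, ⟨hshift, ?_, mem_univ _⟩, (annulusProj_eq_iff.2 ⟨_, rfl⟩).symm⟩
    rw [coverShift_zpow_apply]
    rw [zero_add, zsmul_eq_mul, mul_comm (i : ℝ)] at hi
    push_cast at hi ⊢
    exact Ico_subset_Icc_self hi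
  refine hlift.false_of_periodic hnicis (hKne.image annulusProj) ?_ (image_subset_iff.2 hKint)
    (mul_ne_zero hm hn) ?_
  · rw [hcompact]
    exact ((isCompact_Icc.prod isCompact_univ).inter_left hK).image continuous_annulusProj
  · conv_rhs => rw [← hKft]
    simp only [image_image, hlift.pow_apply]
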